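/- arXiv:1506.01528 — 2 statements merged into one kernel-verified Lean document; each statement's English description precedes it below -/
import Mathlib

section
/- Let (β_n)_{n≥1} be a sequence of complex numbers. Let K ⊆ ℂ be a compact set disjoint from the closed unit disc D̄, containing more than one point, connected, and with connected complement. Set L := D̄ ∪ K (so the connected components of L are K₀ := D̄ and K₁ := K). If the set of limit points of the sequence (|β_n|^{1/n})_{n≥1} has nonempty intersection with the open interval (ρ_L, 1/ρ_L), then U(0, D, K, (β_n)) ≠ ∅. -/
open Filter Topology Metric

/-- The `n`-th partial sum of the Taylor series of `f` at `z₀`: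
`S_n(f,z₀)(z) = Σ_{k=0}^{n} (f^{(k)}(z₀)/k!)·(z−z₀)^k`. -/
noncomputable def taylorSum (f : ℂ → ℂ) (z₀ : ℂ) (n : ℕ) (z : ℂ) : ℂ :=
  ∑ k ∈ Finset.range (n + 1), (iteratedDeriv k f z₀ / (Nat.factorial k)) * (z - z₀) ^ k

/-- Supremum norm of `g` on `X`. -/
noncomputable def supNorm (g : ℂ → ℂ) (X : Set ℂ) : ℝ :=
  sSup ((fun z => ‖g z‖) '' X)

/-- Membership in `A(X)`: continuous on `X` and holomorphic on the interior of `X`. -/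
def memA (X : Set ℂ) (f : ℂ → ℂ) : Prop :=
  ContinuousOn f X ∧ DifferentiableOn ℂ f (interior X)

/-- The universal class `U(0, D, K, (β_n))` of functions `f` holomorphic in the open unit
disc `D` such that `{β_n · S_n(f,0)|_K : n ≥ 1}` is dense in `A(K)` for the sup norm on `K`. -/
def UD (K : Set ℂ) (β : ℕ → ℂ) : Set (ℂ → ℂ) :=
  {f | DifferentiableOn ℂ f (Metric.ball 0 1) ∧ ∀ h : ℂ → ℂ, memA K h → ∀ ε : ℝ, 0 < ε →
    ∃ n : ℕ, 1 ≤ n ∧ supNorm (fun z => β n * taylorSum f 0 n z - h z) K < ε}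

/-- Best sup-norm approximation error of `G` on `L` by polynomials of degree at most `n`. -/
noncomputable def dApprox (L : Set ℂ) (G : ℂ → ℂ) (n : ℕ) : ℝ :=
  sInf {c : ℝ | ∃ p : Polynomial ℂ, p.degree ≤ (n : ℕ) ∧
    c = supNorm (fun z => G z - Polynomial.eval z p) L}

/-- The asymptotic quantity `limsup_n d_n(G)^{1/n}`; for a function `G` which is equal to a
different polynomial on each connected component of `L` this is the asymptotic convergence
factor `ρ_L` of `L`. -/
noncomputable def rho (L : Set ℂ) (G : ℂ → ℂ) : ℝ :=
  Filter.limsup (fun n : ℕ => dApprox L G n ^ (1 / (n : ℝ))) Filter.atTop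


/-- `f` is on `K` a uniform limit of polynomials. -/
def PA (K : Set ℂ) [CompactSpace K] (f : ℂ → ℂ) : Prop :=
  ∃ F ∈ (polynomialFunctions K).topologicalClosure, ∀ z : K, F z = f z

lemma PA.add {K : Set ℂ} [CompactSpace K] {f g : ℂ → ℂ} (hf : PA K f) (hg : PA K g) :
    PA K (fun z => f z + g z) := by
  obtain ⟨F, hF, h1⟩ := hf
  obtain ⟨G, hG, h2⟩ := hg
  exact ⟨F + G, add_mem hF hG, fun z => by simp [h1, h2]⟩

lemma PA.mul {K : Set ℂ} [CompactSpace K] {f g : ℂ → ℂ} (hf : PA K f) (hg : PA K g) :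
    PA K (fun z => f z * g z) := by
  obtain ⟨F, hF, h1⟩ := hf
  obtain ⟨G, hG, h2⟩ := hg
  exact ⟨F * G, mul_mem hF hG, fun z => by simp [h1, h2]⟩

lemma PA.poly (K : Set ℂ) [CompactSpace K] (p : Polynomial ℂ) : PA K (fun z => p.eval z) :=
  ⟨p.toContinuousMapOn K, Subalgebra.le_topologicalClosure (polynomialFunctions K) ⟨p, by simp⟩,
    fun z => by simp⟩

lemma PA.const (K : Set ℂ) [CompactSpace K] (c : ℂ) : PA K (fun _ => c) := by
  simpa using PA.poly K (Polynomial.C c)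

lemma PA.id (K : Set ℂ) [CompactSpace K] : PA K (fun z => z) := by
  simpa using PA.poly K Polynomial.X

lemma PA.sum {K : Set ℂ} [CompactSpace K] {ι : Type*} (s : Finset ι) {f : ι → ℂ → ℂ} (h : ∀ i ∈ s, PA K (f i)) :
    PA K (fun z => ∑ i ∈ s, f i z) := by
  classical
  induction s using Finset.induction_on with
  | empty => simpa using PA.const K 0
  | insert a s ha ih =>
    simp only [Finset.sum_insert ha]
    exact (h a (by simp)).add (ih fun i hi => h i (by simp [hi]))

lemma PA.prod {K : Set ℂ} [CompactSpace K] {ι : Type*} (s : Finset ι) {f : ι → ℂ → ℂ} (h : ∀ i ∈ s, PA K (f i)) :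
    PA K (fun z => ∏ i ∈ s, f i z) := by
  classical
  induction s using Finset.induction_on with
  | empty => simpa using PA.const K 1
  | insert a s ha ih =>
    simp only [Finset.prod_insert ha]
    exact (h a (by simp)).mul (ih fun i hi => h i (by simp [hi]))

lemma PA.pow {K : Set ℂ} [CompactSpace K] {f : ℂ → ℂ} (h : PA K f) (n : ℕ) : PA K (fun z => f z ^ n) := by
  have := PA.prod (Finset.range n) (f := fun _ => f) (fun _ _ => h)
  simpa using this

lemma PA.congr {K : Set ℂ} [CompactSpace K] {f g : ℂ → ℂ} (h : PA K f) (hfg : ∀ z ∈ K, f z = g z) : PA K g := by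
  obtain ⟨F, hF, h1⟩ := h
  exact ⟨F, hF, fun z => by rw [h1, hfg z z.2]⟩

lemma PA.exists_poly {K : Set ℂ} [CompactSpace K] {f : ℂ → ℂ} (h : PA K f) (ε : ℝ) (hε : 0 < ε) :
    ∃ p : Polynomial ℂ, ∀ z ∈ K, ‖p.eval z - f z‖ ≤ ε := by
  obtain ⟨F, hF, h1⟩ := h
  have hF' : F ∈ closure ((polynomialFunctions K : Subalgebra ℂ C(K, ℂ)) : Set C(K, ℂ)) := hF
  obtain ⟨G, ⟨p, hp⟩, hG⟩ := Metric.mem_closure_iff.1 hF' ε hε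
  refine ⟨p, fun z hz => ?_⟩
  have h2 := (ContinuousMap.dist_apply_le_dist (f := F) (g := G) ⟨z, hz⟩).trans hG.le
  rw [dist_comm, dist_eq_norm, h1 ⟨z, hz⟩, ← hp.2] at h2
  simpa using h2

lemma PA.of_limit {K : Set ℂ} [CompactSpace K] {f : ℂ → ℂ} (hc : ContinuousOn f K)
    (h : ∀ ε > 0, ∃ g, PA K g ∧ ∀ z ∈ K, ‖g z - f z‖ ≤ ε) : PA K f := by
  let F : C(K, ℂ) := ⟨K.domRestrict f, hc.domRestrict⟩
  refine ⟨F, ?_, fun z => rfl⟩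
  have hcl : IsClosed ((polynomialFunctions K).topologicalClosure : Set C(K, ℂ)) :=
    Subalgebra.isClosed_topologicalClosure _
  rw [← SetLike.mem_coe, ← hcl.closure_eq]
  refine Metric.mem_closure_iff.2 fun ε hε => ?_
  obtain ⟨g, ⟨G, hG, hGg⟩, hg⟩ := h (ε / 2) (half_pos hε)
  refine ⟨G, hG, ?_⟩
  refine lt_of_le_of_lt ((ContinuousMap.dist_le (half_pos hε).le).2 fun z => ?_) (half_lt_self hε)
  rw [dist_comm, dist_eq_norm, hGg]
  exact hg z z.2

lemma PA.continuousOn {K : Set ℂ} [CompactSpace K] {f : ℂ → ℂ} (h : PA K f) : ContinuousOn f K := by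
  obtain ⟨F, hF, h1⟩ := h
  rw [continuousOn_iff_continuous_domRestrict]
  convert F.continuous using 1
  ext z
  simp [h1]

/-- Composition with an analytic function on the unit disc. -/
lemma PA.comp {K : Set ℂ} [CompactSpace K] {u : ℂ → ℂ} (hu : PA K u)
    (hub : ∀ z ∈ K, ‖u z‖ < 1 / 2) {φ : ℂ → ℂ} (hφ : DifferentiableOn ℂ φ (ball 0 1)) :
    PA K (fun z => φ (u z)) := by
  have h0 : DifferentiableOn ℂ φ (closedBall 0 ((3/4 : NNReal) : ℝ)) :=
    hφ.mono (closedBall_subset_ball (by norm_num))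
  have h1 := h0.hasFPowerSeriesOnBall (by norm_num)
  have h2 := h1.tendstoUniformlyOn (r' := 1/2)
    (by rw [ENNReal.coe_lt_coe, ← NNReal.coe_lt_coe]; norm_num)
  refine PA.of_limit ?_ ?_
  · refine hφ.continuousOn.comp hu.continuousOn fun z hz => ?_
    have := hub z hz
    simp; linarith
  · intro ε hε
    obtain ⟨n, hn⟩ := (Metric.tendstoUniformlyOn_iff.1 h2 ε hε).exists
    refine ⟨fun z => ∑ k ∈ Finset.range n,
      (u z) ^ k * (cauchyPowerSeries φ 0 ((3/4 : NNReal) : ℝ)).coeff k, ?_, fun z hz => ?_⟩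
    · exact PA.sum _ fun k _ => (hu.pow k).mul (PA.const K _)
    · have := hn (u z) (by simpa using hub z hz)
      rw [dist_comm, dist_eq_norm, zero_add] at this
      simp only [FormalMultilinearSeries.partialSum,
        FormalMultilinearSeries.apply_eq_pow_smul_coeff, smul_eq_mul] at this
      exact this.le

/-- Pole pushing. -/
lemma PA.inv {K : Set ℂ} [CompactSpace K] (hKc : IsConnected Kᶜ) {e : ℂ} (he : e ∉ K) :
    PA K (fun z => (z - e)⁻¹) := by
  let S := (polynomialFunctions K).topologicalClosure
  have hS : IsClosed (S : Set C(K, ℂ)) := Subalgebra.isClosed_topologicalClosure _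
  let x : S := ⟨Polynomial.X.toContinuousMapOn K,
    Subalgebra.le_topologicalClosure _ ⟨Polynomial.X, by simp⟩⟩
  have hspec : (spectrum ℂ (x : C(K, ℂ))) = K := by
    rw [ContinuousMap.spectrum_eq_range]
    ext z
    simp [x]
  have hnot : e ∉ spectrum ℂ x := by
    intro hz
    have h1 := Subalgebra.spectrum_isBounded_connectedComponentIn S x hz
    rw [hspec] at h1
    rw [hKc.isPreconnected.connectedComponentIn he] at h1
    have h2 := h1.union (isCompact_iff_compactSpace.2 inferInstance : IsCompact K).isBounded
    rw [Set.compl_union_self] at h2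
    exact NormedSpace.unbounded_univ ℂ ℂ h2
  rw [spectrum.notMem_iff] at hnot
  obtain ⟨v, hv⟩ := hnot.exists_right_inv
  refine ⟨-(v : C(K, ℂ)), neg_mem v.2, fun z => ?_⟩
  have h3 := congrArg (fun y : S => (y : C(K, ℂ)) z) hv
  have hne : (z : ℂ) - e ≠ 0 := fun h => he (by rw [← sub_eq_zero.1 h]; exact z.2)
  simp [x, Algebra.algebraMap_eq_smul_one] at h3
  apply mul_left_cancel₀ hne
  rw [mul_inv_cancel₀ hne, ContinuousMap.neg_apply]
  linear_combination h3


lemma exists_chain {K : Set ℂ} (hK : IsCompact K) (hKc : IsConnected Kᶜ) {c : ℂ} (hc : c ∉ K)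
    {r : ℝ} (hr : 0 < r) : ∃ ε > 0, ε ≤ r / 2 ∧ ∃ (n : ℕ) (e : ℕ → ℂ), e 0 = c ∧
      (∀ i < n, ‖e (i + 1) - e i‖ < ε / 2) ∧ (∀ i ≤ n, ∀ z ∈ K, ε ≤ ‖z - e i‖) ∧
      (∀ i ≤ n, ‖e i - c‖ ≤ 3 / 2 * r) ∧ r ≤ ‖e n - c‖ := by
  obtain ⟨q, hq, hqr⟩ : ∃ q ∈ Kᶜ, r ≤ ‖q - c‖ := by
    by_contra! hcon
    have h1 : Bornology.IsBounded Kᶜ := by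
      refine (Metric.isBounded_ball (x := c) (r := r)).subset fun q hq => ?_
      rw [mem_ball, dist_eq_norm]; exact hcon q hq
    have h2 := h1.union hK.isBounded
    rw [Set.compl_union_self] at h2
    exact NormedSpace.unbounded_univ ℂ ℂ h2
  have hpc : IsPathConnected Kᶜ := hK.isClosed.isOpen_compl.isConnected_iff_isPathConnected.1 hKc
  obtain ⟨γ, hγ⟩ := hpc.joinedIn c hc q hq
  have hcomp : IsCompact (Set.range γ) := isCompact_range γ.continuous
  have hdisj : Disjoint (Set.range γ) K := by
    rw [Set.disjoint_left]
    rintro _ ⟨t, rfl⟩ h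
    exact hγ t h
  obtain ⟨ε₀, hε₀, hth⟩ := hdisj.exists_thickenings hcomp hK.isClosed
  have hdist : ∀ x ∈ Set.range γ, ∀ z ∈ K, ε₀ ≤ ‖z - x‖ := by
    intro x hx z hz
    by_contra! hcon
    have h1 : z ∈ thickening ε₀ (Set.range γ) := by
      rw [mem_thickening_iff]
      exact ⟨x, hx, by rwa [dist_eq_norm]⟩
    exact Set.disjoint_left.1 hth h1 (self_subset_thickening hε₀ _ hz)
  set ε := min ε₀ (r / 2) with hε
  have hε0 : 0 < ε := by positivity
  have huc : UniformContinuousOn γ.extend (Set.Icc 0 1) :=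
    isCompact_Icc.uniformContinuousOn_of_continuous γ.continuous_extend.continuousOn
  obtain ⟨δ, hδ, huc⟩ := Metric.uniformContinuousOn_iff.1 huc (ε / 2) (by positivity)
  obtain ⟨N, hN⟩ := exists_nat_one_div_lt hδ
  set e : ℕ → ℂ := fun i => γ.extend ((i : ℝ) / (N + 1)) with he
  have heN : e (N + 1) = q := by
    simp only [he]
    rw [Nat.cast_add, Nat.cast_one, div_self (by positivity)]
    exact γ.extend_one
  have he0 : e 0 = c := by simp [he]
  have hrange : ∀ i, e i ∈ Set.range γ := by
    intro i
    rw [← γ.extend_range]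
    exact ⟨_, rfl⟩
  have hex : ∃ i, r ≤ ‖e i - c‖ := ⟨N + 1, by rw [heN]; exact hqr⟩
  classical
  set n := Nat.find hex with hn
  have hnN : n ≤ N + 1 := Nat.find_min' hex (by rw [heN]; exact hqr)
  have hlt : ∀ i < n, ‖e i - c‖ < r := fun i hi => not_le.1 (Nat.find_min hex hi)
  have hstep : ∀ i < n, ‖e (i + 1) - e i‖ < ε / 2 := by
    intro i hi
    have hi1 : (i : ℝ) + 1 ≤ N + 1 := by exact_mod_cast (show i + 1 ≤ N + 1 by omega)
    rw [← dist_eq_norm]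
    apply huc
    · constructor
      · positivity
      · rw [div_le_one (by positivity)]; push_cast; exact hi1
    · constructor
      · positivity
      · rw [div_le_one (by positivity)]; linarith
    · rw [Real.dist_eq, ← sub_div]
      push_cast
      rw [add_sub_cancel_left, abs_of_pos (by positivity)]
      exact hN
  refine ⟨ε, hε0, min_le_right _ _, n, e, he0, hstep, ?_, ?_, Nat.find_spec hex⟩
  · intro i hi z hz
    exact (min_le_left _ _).trans (hdist _ (hrange i) z hz)
  · intro i hi
    rcases hi.lt_or_eq with h | h
    · linarith [hlt i h]
    · rcases Nat.eq_zero_or_pos n with h0 | h0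
      · rw [h, h0, he0]; simp; positivity
      · obtain ⟨k, hk⟩ := Nat.exists_eq_succ_of_ne_zero h0.ne'
        have h1 := hlt k (by omega)
        have h2 := hstep k (by omega)
        rw [h, hk]
        have h3 : ‖e (k + 1) - c‖ ≤ ‖e (k + 1) - e k‖ + ‖e k - c‖ := norm_sub_le_norm_sub_add_norm_sub _ _ _
        have h4 : ε ≤ r / 2 := min_le_right _ _
        show ‖e (k + 1) - c‖ ≤ _
        linarith

lemma Q_bound {x g d τ : ℂ} {r : ℝ} (hr : 0 < r) (hd2 : ‖d‖ ≤ 3 / 2 * r)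
    (hτ : ‖τ‖ ≤ 7 / 4 * r) (hxτ : x ≠ τ) (hq : g * x = 1 + d ^ 2 / 16 * g ^ 2)
    (hnear : ‖x‖ ≤ 4 * r → ‖g‖ ≤ 72 / r) (hfar : 4 * r ≤ ‖x‖ → ‖g‖ * ‖d‖ ≤ 4) :
    ‖g + τ * g ^ 2 - 1 / (x - τ)‖ ≤
      3000000 * (r ^ 2 / (‖x - τ‖ * (r ^ 2 + ‖x - τ‖ ^ 2))) := by
  have hw : 0 < ‖x - τ‖ := norm_pos_iff.2 (sub_ne_zero.2 hxτ)
  rcases le_total ‖x‖ (4 * r) with h | h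
  · have hg := hnear h
    have hwr : ‖x - τ‖ ≤ 6 * r := (norm_sub_le _ _).trans (by linarith)
    have h1 : ‖g + τ * g ^ 2 - 1 / (x - τ)‖ ≤ 9144 / r + 1 / ‖x - τ‖ := by
      refine (norm_sub_le _ _).trans ?_
      rw [norm_div, norm_one]
      gcongr
      refine (norm_add_le _ _).trans ?_
      rw [norm_mul, norm_pow]
      calc ‖g‖ + ‖τ‖ * ‖g‖ ^ 2 ≤ 72 / r + 7 / 4 * r * (72 / r) ^ 2 := by gcongr
        _ = 9144 / r := by field_simp; norm_num
    refine h1.trans ?_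
    set w := ‖x - τ‖
    rw [div_add_div _ _ hr.ne' hw.ne', mul_div_assoc', div_le_div_iff₀ (by positivity) (by positivity)]
    have h3 : w ^ 2 ≤ 36 * r ^ 2 := by nlinarith
    have h4 : (9144 * w + r * 1) * (r ^ 2 + w ^ 2) ≤ (9144 * (6 * r) + r * 1) * (r ^ 2 + 36 * r ^ 2) := by
      gcongr
    calc (9144 * w + r * 1) * (w * (r ^ 2 + w ^ 2)) = w * ((9144 * w + r * 1) * (r ^ 2 + w ^ 2)) := by ring
      _ ≤ w * ((9144 * (6 * r) + r * 1) * (r ^ 2 + 36 * r ^ 2)) := by gcongr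
      _ = 2030005 * (w * r ^ 3) := by ring
      _ ≤ _ := by
          have : 0 ≤ w * r ^ 3 := by positivity
          nlinarith
  · have hg := hfar h
    have hx0 : 0 < ‖x‖ := by linarith
    have hx : x ≠ 0 := norm_pos_iff.1 hx0
    have hgx : ‖g‖ ≤ 2 / ‖x‖ := by
      rw [le_div_iff₀ hx0, ← norm_mul, hq]
      refine (norm_add_le _ _).trans ?_
      rw [norm_one, norm_mul, norm_div, norm_pow, norm_pow]
      have : (‖g‖ * ‖d‖) ^ 2 ≤ 4 ^ 2 := by gcongr
      have h16 : ‖(16 : ℂ)‖ = 16 := by simp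
      rw [h16]
      nlinarith
    have hgd : ‖g - 1 / x‖ ≤ r ^ 2 / ‖x‖ ^ 3 := by
      have e1 : g - 1 / x = d ^ 2 / 16 * g ^ 2 / x := by
        field_simp
        linear_combination 16 * hq
      have h16 : ‖(16 : ℂ)‖ = 16 := by simp
      rw [e1, norm_div, norm_mul, norm_div, norm_pow, norm_pow, h16]
      calc ‖d‖ ^ 2 / 16 * ‖g‖ ^ 2 / ‖x‖ ≤ (3 / 2 * r) ^ 2 / 16 * (2 / ‖x‖) ^ 2 / ‖x‖ := by gcongr
        _ = 9 / 16 * (r ^ 2 / ‖x‖ ^ 3) := by field_simp; norm_num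
        _ ≤ r ^ 2 / ‖x‖ ^ 3 := by
          have : 0 ≤ r ^ 2 / ‖x‖ ^ 3 := by positivity
          linarith
    have hw2 : ‖x‖ / 2 ≤ ‖x - τ‖ := by
      have := norm_sub_norm_le x τ
      linarith
    have hw3 : ‖x - τ‖ ≤ 3 / 2 * ‖x‖ := (norm_sub_le _ _).trans (by linarith)
    have hxτ' : x - τ ≠ 0 := sub_ne_zero.2 hxτ
    have e2 : g + τ * g ^ 2 - 1 / (x - τ) =
        (g - 1 / x) + τ * ((g - 1 / x) * (g + 1 / x)) - τ ^ 2 / (x ^ 2 * (x - τ)) := by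
      field_simp
      ring
    have hb1 : ‖τ * ((g - 1 / x) * (g + 1 / x))‖ ≤ 2 * (r ^ 2 / ‖x‖ ^ 3) := by
      have h5 : ‖g + 1 / x‖ ≤ 3 / ‖x‖ := by
        refine (norm_add_le _ _).trans ?_
        rw [norm_div, norm_one]
        calc ‖g‖ + 1 / ‖x‖ ≤ 2 / ‖x‖ + 1 / ‖x‖ := by gcongr
          _ = _ := by ring
      rw [norm_mul, norm_mul]
      calc ‖τ‖ * (‖g - 1 / x‖ * ‖g + 1 / x‖) ≤ 7 / 4 * r * (r ^ 2 / ‖x‖ ^ 3 * (3 / ‖x‖)) := by gcongr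
        _ = 21 / 4 * (r / ‖x‖) * (r ^ 2 / ‖x‖ ^ 3) := by field_simp; norm_num
        _ ≤ 2 * (r ^ 2 / ‖x‖ ^ 3) := by
          have : r / ‖x‖ ≤ 1 / 4 := by rw [div_le_div_iff₀ hx0 (by norm_num)]; linarith
          gcongr
          linarith
    have hb2 : ‖τ ^ 2 / (x ^ 2 * (x - τ))‖ ≤ 7 * (r ^ 2 / ‖x‖ ^ 3) := by
      rw [norm_div, norm_mul, norm_pow, norm_pow]
      calc ‖τ‖ ^ 2 / (‖x‖ ^ 2 * ‖x - τ‖) ≤ (7 / 4 * r) ^ 2 / (‖x‖ ^ 2 * (‖x‖ / 2)) := by gcongr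
        _ = 49 / 8 * (r ^ 2 / ‖x‖ ^ 3) := by field_simp; norm_num
        _ ≤ _ := by gcongr; norm_num
    rw [e2]
    have h6 : ‖(g - 1 / x) + τ * ((g - 1 / x) * (g + 1 / x)) - τ ^ 2 / (x ^ 2 * (x - τ))‖ ≤
        10 * (r ^ 2 / ‖x‖ ^ 3) := by
      refine (norm_sub_le _ _).trans ?_
      have := norm_add_le (g - 1 / x) (τ * ((g - 1 / x) * (g + 1 / x)))
      linarith
    refine h6.trans ?_
    have h7 : r ^ 2 / (4 * ‖x‖ ^ 3) ≤ r ^ 2 / (‖x - τ‖ * (r ^ 2 + ‖x - τ‖ ^ 2)) := by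
      apply div_le_div_of_nonneg_left (by positivity) (by positivity)
      calc ‖x - τ‖ * (r ^ 2 + ‖x - τ‖ ^ 2) ≤ (3 / 2 * ‖x‖) * ((‖x‖ / 4) ^ 2 + (3 / 2 * ‖x‖) ^ 2) := by
            gcongr
            linarith
        _ = 111 / 32 * ‖x‖ ^ 3 := by ring
        _ ≤ 4 * ‖x‖ ^ 3 := by gcongr; norm_num
    have h8 : r ^ 2 / (4 * ‖x‖ ^ 3) = r ^ 2 / ‖x‖ ^ 3 / 4 := by field_simp
    have h9 : 0 ≤ r ^ 2 / ‖x‖ ^ 3 := by positivity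
    rw [h8] at h7
    linarith


/-- square root of `1 + u` -/
noncomputable def sq1 (u : ℂ) : ℂ := Complex.exp (Complex.log (1 + u) / 2)

lemma sq1_slit {u : ℂ} (hu : ‖u‖ < 1) : 1 + u ∈ Complex.slitPlane :=
  Complex.mem_slitPlane_of_norm_lt_one hu

lemma sq1_sq {u : ℂ} (hu : ‖u‖ < 1) : sq1 u ^ 2 = 1 + u := by
  rw [sq1, ← Complex.exp_nat_mul]
  push_cast
  rw [mul_div_cancel₀ _ (by norm_num : (2:ℂ) ≠ 0),
    Complex.exp_log (Complex.slitPlane_ne_zero (sq1_slit hu))]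

lemma sq1_diff {u : ℂ} (hu : ‖u‖ < 1) : DifferentiableAt ℂ sq1 u := by
  have h1 : DifferentiableAt ℂ (fun u : ℂ => Complex.log (1 + u)) u :=
    (differentiableAt_id.const_add (1:ℂ)).clog (sq1_slit hu)
  exact (h1.div_const 2).cexp

lemma sq1_zero : sq1 0 = 1 := by simp [sq1]

/-- product of square roots along a chain -/
noncomputable def chainH (e : ℕ → ℂ) (n : ℕ) (z : ℂ) : ℂ :=
  ∏ i ∈ Finset.range n, sq1 ((e (i + 1) - e i) / (z - e (i + 1)))

lemma chain_u {e : ℕ → ℂ} {n : ℕ} {ε : ℝ} (hε : 0 < ε)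
    (hstep : ∀ i < n, ‖e (i + 1) - e i‖ < ε / 2) {z : ℂ} (hz : ∀ i ≤ n, ε ≤ ‖z - e i‖)
    {i : ℕ} (hi : i < n) : ‖(e (i + 1) - e i) / (z - e (i + 1))‖ < 1 / 2 := by
  have h1 := hz (i + 1) hi
  rw [norm_div, div_lt_iff₀ (by linarith)]
  linarith [hstep i hi]

lemma chainH_sq {e : ℕ → ℂ} {n : ℕ} {ε : ℝ} (hε : 0 < ε)
    (hstep : ∀ i < n, ‖e (i + 1) - e i‖ < ε / 2) {z : ℂ} (hz : ∀ i ≤ n, ε ≤ ‖z - e i‖) :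
    chainH e n z ^ 2 * (z - e n) = z - e 0 := by
  induction n with
  | zero => simp [chainH]
  | succ n ih =>
    have ih' := ih (fun i hi => hstep i (by omega)) (fun i hi => hz i (by omega))
    have hu := chain_u hε hstep hz (Nat.lt_succ_self n)
    have hne : z - e (n + 1) ≠ 0 := norm_pos_iff.1 (hε.trans_le (hz (n + 1) le_rfl))
    have e1 : chainH e (n + 1) z = chainH e n z * sq1 ((e (n + 1) - e n) / (z - e (n + 1))) := by
      simp [chainH, Finset.prod_range_succ]
    rw [e1, mul_pow, sq1_sq (hu.trans (by norm_num)), ← ih']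
    field_simp
    ring

lemma chainH_cont {e : ℕ → ℂ} {n : ℕ} {ε : ℝ} (hε : 0 < ε)
    (hstep : ∀ i < n, ‖e (i + 1) - e i‖ < ε / 2) {z : ℂ} (hz : ∀ i ≤ n, ε ≤ ‖z - e i‖) :
    ContinuousAt (chainH e n) z := by
  unfold chainH
  refine tendsto_finsetProd _ fun i hi => ?_
  have hi' := Finset.mem_range.1 hi
  have hne : z - e (i + 1) ≠ 0 := norm_pos_iff.1 (hε.trans_le (hz (i + 1) hi'))
  have hu := chain_u hε hstep hz hi'
  have h1 : ContinuousAt sq1 ((e (i + 1) - e i) / (z - e (i + 1))) :=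
    (sq1_diff (hu.trans (by norm_num))).continuousAt
  have h2 : ContinuousAt (fun z => (e (i + 1) - e i) / (z - e (i + 1))) z :=
    continuousAt_const.div (continuousAt_id.sub continuousAt_const) hne
  exact ContinuousAt.comp (f := fun z => (e (i + 1) - e i) / (z - e (i + 1))) h1 h2

lemma chainH_lim {e : ℕ → ℂ} {n : ℕ} {m x : ℂ} (hx : x ≠ 0) :
    Tendsto (fun s : ℝ => chainH e n (m + s * x)) atTop (𝓝 1) := by
  have : (1 : ℂ) = ∏ i ∈ Finset.range n, (1:ℂ) := by simp
  rw [this]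
  unfold chainH
  refine tendsto_finsetProd _ fun i hi => ?_
  have h1 : ContinuousAt sq1 0 := (sq1_diff (by simp)).continuousAt
  have h2 : Tendsto (fun s : ℝ => (e (i + 1) - e i) / (m + s * x - e (i + 1))) atTop (𝓝 0) := by
    have h3 : Tendsto (fun s : ℝ => (s : ℂ) * x) atTop (Bornology.cobounded ℂ) := by
      rw [← tendsto_norm_atTop_iff_cobounded]
      simp only [norm_mul, Complex.norm_real, Real.norm_eq_abs]
      exact tendsto_abs_atTop_atTop.atTop_mul_const (norm_pos_iff.2 hx)
    have h4 := (tendsto_add_const_cobounded (m - e (i + 1))).comp h3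
    have h6 := (tendsto_inv₀_cobounded.comp h4).const_mul (e (i + 1) - e i)
    rw [mul_zero] at h6
    refine h6.congr fun s => ?_
    simp only [Function.comp_apply, div_eq_mul_inv]
    congr 2
    ring
  have h5 := h1.tendsto.comp h2
  rw [sq1_zero] at h5
  exact h5


lemma exists_Q {K : Set ℂ} [CompactSpace K] (hKc : IsConnected Kᶜ) {c : ℂ} (hc : c ∉ K)
    {r : ℝ} (hr : 0 < r) : ∃ (g : ℂ → ℂ) (m : ℂ), PA K g ∧ ∀ ζ, ‖ζ - c‖ ≤ r → ∀ z ∈ K, z ≠ ζ →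
      ‖g z + (ζ - m) * g z ^ 2 - 1 / (z - ζ)‖ ≤
        3000000 * (r ^ 2 / (‖z - ζ‖ * (r ^ 2 + ‖z - ζ‖ ^ 2))) := by
  have hK : IsCompact K := isCompact_iff_compactSpace.2 inferInstance
  obtain ⟨ε, hε, hεr, n, e, he0, hstep, heK, her, hen⟩ := exists_chain hK hKc hc hr
  set q := e n with hq
  set d := q - c with hd
  set m := (c + q) / 2 with hm
  set S : ℂ → ℂ := fun z => (z - q) * chainH e n z with hS
  have hd1 : r ≤ ‖d‖ := hen
  have hd2 : ‖d‖ ≤ 3 / 2 * r := her n le_rfl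
  have hd0 : d ≠ 0 := norm_pos_iff.1 (hr.trans_le hd1)
  have hSsq : ∀ z, (∀ i ≤ n, ε ≤ ‖z - e i‖) → S z ^ 2 = (z - m) ^ 2 - d ^ 2 / 4 := by
    intro z hz
    have h1 := chainH_sq hε hstep hz
    rw [he0] at h1
    simp only [hS, hm, hd]
    linear_combination (z - q) * h1
  set g : ℂ → ℂ := fun z => 8 / d ^ 2 * (z - m - S z) with hg
  -- membership
  have hgPA : PA K g := by
    have h1 : PA K (chainH e n) := by
      unfold chainH
      refine PA.prod _ fun i hi => ?_
      have hi' := Finset.mem_range.1 hi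
      have hnot : e (i + 1) ∉ K := fun h => by
        have := heK (i + 1) hi' _ h
        simp at this
        linarith
      refine PA.comp (u := fun z => (e (i + 1) - e i) / (z - e (i + 1))) ?_ ?_ (φ := sq1) ?_
      · simp only [div_eq_mul_inv]
        exact (PA.const K _).mul (PA.inv hKc hnot)
      · intro z hz
        exact chain_u hε hstep (fun i hi => heK i hi z hz) hi'
      · intro u hu
        exact (sq1_diff (by simpa using hu)).differentiableWithinAt
    have h2 : PA K S := by
      have := ((PA.id K).add (PA.const K (-q))).mul h1
      exact this.congr fun z _ => by simp only [hS]; ring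
    have h3 := (PA.const K (8 / d ^ 2)).mul
      (((PA.id K).add (PA.const K (-m))).add ((PA.const K (-1)).mul h2))
    exact h3.congr fun z _ => by simp only [hg]; ring
  have hmc : ‖m - c‖ ≤ 3 / 4 * r := by
    have : m - c = d / 2 := by rw [hm, hd]; ring
    rw [this, norm_div]
    have h2 : ‖(2:ℂ)‖ = 2 := by simp
    rw [h2]; linarith
  refine ⟨g, m, hgPA, fun ζ hζ z hz hzζ => ?_⟩
  have hgood : ∀ i ≤ n, ε ≤ ‖z - e i‖ := fun i hi => heK i hi z hz
  have hS2 := hSsq z hgood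
  set x := z - m with hx
  have key : (x - S z) * (x + S z) = d ^ 2 / 4 := by linear_combination -hS2
  have hgq : g z * x = 1 + d ^ 2 / 16 * g z ^ 2 := by
    simp only [hg, ← hx]
    clear_value S
    generalize S z = T at hS2 ⊢
    have e1 : d ^ 2 / 16 * (8 / d ^ 2 * (x - T)) ^ 2 = 4 * (x - T) ^ 2 / d ^ 2 := by
      clear_value d
      field_simp
      ring
    have e2 : (1 : ℂ) = d ^ 2 / d ^ 2 := by clear_value d; field_simp
    rw [e1, e2, div_mul_eq_mul_div, div_mul_eq_mul_div, ← add_div]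
    congr 1
    linear_combination (-4 : ℂ) * hS2
  have hgn : ‖g z‖ = 8 / ‖d‖ ^ 2 * ‖x - S z‖ := by
    simp only [hg, ← hx, norm_mul, norm_div, norm_pow]
    simp
  have hdp : 0 < ‖d‖ := hr.trans_le hd1
  have hnear : ‖x‖ ≤ 4 * r → ‖g z‖ ≤ 72 / r := by
    intro h
    have h1 : ‖S z‖ ^ 2 ≤ (5 * r) ^ 2 := by
      rw [← norm_pow, hS2]
      refine (norm_sub_le _ _).trans ?_
      rw [norm_div, norm_pow, norm_pow]
      have h4 : ‖(4:ℂ)‖ = 4 := by simp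
      rw [h4]
      have : ‖x‖ ^ 2 ≤ (4 * r) ^ 2 := by gcongr
      have : ‖d‖ ^ 2 ≤ (3 / 2 * r) ^ 2 := by gcongr
      nlinarith
    have h2 : ‖S z‖ ≤ 5 * r := (sq_le_sq₀ (norm_nonneg _) (by positivity)).1 h1
    have h3 : ‖x - S z‖ ≤ 9 * r := (norm_sub_le _ _).trans (by linarith)
    rw [hgn]
    calc 8 / ‖d‖ ^ 2 * ‖x - S z‖ ≤ 8 / r ^ 2 * (9 * r) := by gcongr
      _ = 72 / r := by field_simp; norm_num
  have hfar : 4 * r ≤ ‖x‖ → ‖g z‖ * ‖d‖ ≤ 4 := by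
    intro h
    have hx0 : x ≠ 0 := norm_pos_iff.1 (by linarith)
    have hgs : ∀ s : ℝ, 1 ≤ s → ∀ i ≤ n, ε ≤ ‖(m + s * x) - e i‖ := by
      intro s hs i hi
      have h1 : ‖x‖ ≤ ‖(s : ℂ) * x‖ := by
        rw [norm_mul, Complex.norm_real, Real.norm_eq_abs, abs_of_pos (by linarith)]
        nlinarith [norm_nonneg x]
      have h2 : (s : ℂ) * x = ((m + s * x) - e i) + (e i - c) - (m - c) := by ring
      have h3 : ‖(s : ℂ) * x‖ ≤ ‖(m + s * x) - e i‖ + ‖e i - c‖ + ‖m - c‖ := by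
        conv_lhs => rw [h2]
        exact (norm_sub_le _ _).trans (by gcongr; exact norm_add_le _ _)
      have := her i hi
      linarith
    set v : ℝ → ℂ := fun s => S (m + s * x) / (s * x) with hv
    have hvc : ContinuousOn (fun s => (v s).re) (Set.Ici 1) := by
      intro s hs
      have hs' : (1:ℝ) ≤ s := hs
      have hsx : (s : ℂ) * x ≠ 0 := mul_ne_zero (by
        rw [Ne, Complex.ofReal_eq_zero]; linarith) hx0
      have h1 : ContinuousAt (fun s : ℝ => m + (s:ℂ) * x) s := by fun_prop
      have h2 : ContinuousAt (fun s : ℝ => chainH e n (m + (s:ℂ) * x)) s :=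
        ContinuousAt.comp (f := fun s : ℝ => m + (s:ℂ) * x)
          (chainH_cont hε hstep (hgs s hs')) h1
      have h3 : ContinuousAt v s := by
        simp only [hv, hS]
        refine ContinuousAt.div ((h1.sub continuousAt_const).mul h2) (by fun_prop) hsx
      exact (Complex.continuous_re.continuousAt.comp h3).continuousWithinAt
    have hvn : ∀ s : ℝ, 1 ≤ s → (v s).re ≠ 0 := by
      intro s hs h0
      have hs0 : (s : ℂ) ≠ 0 := by rw [Ne, Complex.ofReal_eq_zero]; linarith
      have h1 : v s ^ 2 = 1 - d ^ 2 / (4 * (s * x) ^ 2) := by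
        simp only [hv, div_pow]
        rw [hSsq _ (hgs s hs)]
        field_simp
        ring
      have h2 : ‖d ^ 2 / (4 * (s * x) ^ 2)‖ < 1 := by
        rw [norm_div, norm_mul, norm_pow, norm_pow, norm_mul, Complex.norm_real, Real.norm_eq_abs,
          abs_of_pos (by linarith)]
        have h4 : ‖(4:ℂ)‖ = 4 := by simp
        rw [h4, div_lt_one (by positivity)]
        have h5 : ‖d‖ < s * ‖x‖ := by nlinarith
        have h6 : ‖d‖ ^ 2 < (s * ‖x‖) ^ 2 := by gcongr
        nlinarith
      have h3 : (v s ^ 2).re ≤ 0 := by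
        rw [sq, Complex.mul_re, h0]
        nlinarith [sq_nonneg (v s).im]
      rw [h1, Complex.sub_re, Complex.one_re] at h3
      have := Complex.re_le_norm (d ^ 2 / (4 * (s * x) ^ 2))
      linarith
    have hvl : Tendsto (fun s => (v s).re) atTop (𝓝 1) := by
      have h1 : Tendsto (fun s : ℝ => (1 - (d / 2 / x) * ((s⁻¹ : ℝ) : ℂ)) * chainH e n (m + s * x)) atTop
          (𝓝 ((1 - (d / 2 / x) * ((0:ℝ):ℂ)) * 1)) := by
        refine Tendsto.mul (Tendsto.const_sub _ (Tendsto.const_mul _ ?_)) (chainH_lim hx0)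
        exact (Complex.continuous_ofReal.tendsto 0).comp tendsto_inv_atTop_zero
      have h2 : Tendsto v atTop (𝓝 1) := by
        have h3 := h1
        simp only [Complex.ofReal_zero, mul_zero, sub_zero, mul_one] at h3
        refine h3.congr' ?_
        filter_upwards [eventually_gt_atTop 0] with s hs
        have hs0 : (s : ℂ) ≠ 0 := by rw [Ne, Complex.ofReal_eq_zero]; linarith
        simp only [hv, hS, Complex.ofReal_inv, hm, hd]
        field_simp
        ring
      have := (Complex.continuous_re.tendsto 1).comp h2
      rw [Complex.one_re] at this
      exact this
    have hv1 : 0 < (v 1).re := by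
      by_contra! hcon
      obtain ⟨s, hs1, hs2⟩ := ((hvl.eventually (lt_mem_nhds one_pos)).and
        (eventually_ge_atTop 1)).exists
      have h1 := intermediate_value_Icc hs2 (hvc.mono Set.Icc_subset_Ici_self)
      obtain ⟨t, ht, ht0⟩ := h1 ⟨hcon, hs1.le⟩
      exact hvn t ht.1 ht0
    have hv1' : v 1 = S z / x := by
      simp only [hv, Complex.ofReal_one, one_mul]
      rw [hx, add_sub_cancel]
    have hle : ‖x - S z‖ ≤ ‖x + S z‖ := by
      have h1 : x - S z = x * (1 - v 1) := by rw [hv1']; field_simp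
      have h2 : x + S z = x * (1 + v 1) := by rw [hv1']; field_simp
      rw [h1, h2, norm_mul, norm_mul]
      gcongr
      refine (sq_le_sq₀ (norm_nonneg _) (norm_nonneg _)).1 ?_
      rw [← Complex.normSq_eq_norm_sq, ← Complex.normSq_eq_norm_sq, Complex.normSq_apply,
        Complex.normSq_apply]
      simp only [Complex.sub_re, Complex.add_re, Complex.sub_im, Complex.add_im, Complex.one_re,
        Complex.one_im]
      nlinarith
    have h5 : ‖x - S z‖ ^ 2 ≤ (‖d‖ / 2) ^ 2 := by
      have h6 := congrArg norm key
      rw [norm_mul, norm_div, norm_pow] at h6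
      have h4 : ‖(4:ℂ)‖ = 4 := by simp
      rw [h4] at h6
      nlinarith [norm_nonneg (x - S z)]
    have h7 : ‖x - S z‖ ≤ ‖d‖ / 2 := (sq_le_sq₀ (norm_nonneg _) (by positivity)).1 h5
    rw [hgn]
    calc 8 / ‖d‖ ^ 2 * ‖x - S z‖ * ‖d‖ ≤ 8 / ‖d‖ ^ 2 * (‖d‖ / 2) * ‖d‖ := by gcongr
      _ = 4 := by field_simp; norm_num
  have hτ : ‖ζ - m‖ ≤ 7 / 4 * r := by
    have : ζ - m = (ζ - c) - (m - c) := by ring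
    rw [this]
    exact (norm_sub_le _ _).trans (by linarith)
  have hzz : z - ζ = x - (ζ - m) := by rw [hx]; ring
  rw [hzz]
  refine Q_bound hr hd2 hτ ?_ hgq hnear hfar
  intro h
  apply hzζ
  rw [hx] at h
  exact sub_left_injective h

open MeasureTheory Real in
lemma polar_int {g : ℂ → ℂ} (hm : Measurable g) (hi : Integrable g) :
    ∫ s, g s = ∫ r in Set.Ioi (0:ℝ), r * ∫ θ in (0:ℝ)..2 * π, g (circleMap 0 r θ) := by
  have hsymm : ∀ p : ℝ × ℝ, Complex.polarCoord.symm p = circleMap 0 p.1 p.2 := by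
    intro p
    rw [Complex.polarCoord_symm_apply, circleMap_zero, Complex.exp_mul_I]
    push_cast
    rfl
  have hmeas : Measurable fun p : ℝ × ℝ => circleMap 0 p.1 p.2 := by
    unfold circleMap
    fun_prop
  have hprodInt : IntegrableOn (fun p : ℝ × ℝ => (p.1 : ℂ) * g (circleMap 0 p.1 p.2))
      (Set.Ioi (0:ℝ) ×ˢ Set.Ioo (-π) π) (volume.prod volume) := by
    refine ⟨?_, ?_⟩
    · refine Measurable.aestronglyMeasurable ?_
      exact (Complex.measurable_ofReal.comp measurable_fst).mul (hm.comp hmeas)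
    · have h1 := Complex.lintegral_comp_polarCoord_symm (fun s => ‖g s‖ₑ)
      have h2 : ∫⁻ s, ‖g s‖ₑ < ⊤ := hi.2
      rw [← h1] at h2
      refine lt_of_le_of_lt (le_of_eq ?_) h2
      rw [← Measure.volume_eq_prod]
      refine setLIntegral_congr_fun ?_ ?_
      · exact measurableSet_Ioi.prod measurableSet_Ioo
      · intro p hp
        have hp1 : 0 < p.1 := hp.1
        simp only [hsymm, enorm_mul, smul_eq_mul]
        congr 1
        rw [← ofReal_norm, Complex.norm_real, Real.norm_eq_abs, abs_of_pos hp1]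
  rw [← Complex.integral_comp_polarCoord_symm]
  have h3 : polarCoord.target = Set.Ioi (0:ℝ) ×ˢ Set.Ioo (-π) π := rfl
  simp only [hsymm, Complex.real_smul]
  rw [h3, Measure.volume_eq_prod, setIntegral_prod _ hprodInt]
  refine setIntegral_congr_fun measurableSet_Ioi fun r hr => ?_
  simp only
  rw [integral_const_mul]
  congr 1
  have h4 := ((periodic_circleMap 0 r).comp g).intervalIntegral_add_eq (-π) 0
  simp only [Function.comp_def] at h4
  rw [zero_add] at h4
  rw [← h4, intervalIntegral.integral_of_le (by linarith [pi_pos]), integral_Ioc_eq_integral_Ioo]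
  congr 3
  ring

open MeasureTheory Real in
lemma polar_circle {β : ℝ → ℂ} {h : ℂ → ℂ} (hm : Measurable fun s => s * β ‖s‖ * h s)
    (hi : Integrable fun s => s * β ‖s‖ * h s) :
    ∫ s, s * β ‖s‖ * h s = ∫ r in Set.Ioi (0:ℝ), r * (β r * (-Complex.I * ∮ s in C(0, r), h s)) := by
  rw [polar_int hm hi]
  refine setIntegral_congr_fun measurableSet_Ioi fun r hr => ?_
  have hr' : 0 < r := hr
  congr 1
  rw [circleIntegral, ← mul_assoc, ← intervalIntegral.integral_const_mul]
  refine intervalIntegral.integral_congr fun θ _ => ?_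
  simp only [norm_circleMap_zero, abs_of_pos hr', deriv_circleMap, smul_eq_mul]
  linear_combination (circleMap 0 r θ * β r * h (circleMap 0 r θ)) * Complex.I_mul_I

open MeasureTheory in
lemma locInt_inv : LocallyIntegrable (fun z : ℂ => z⁻¹) := by
  refine locallyIntegrable_of_norm_le_rpow (C := 1) (α := 1) ?_ ?_ ?_ ?_
  · simp
  · simp
  · refine Eventually.of_forall fun z => ?_
    rw [norm_inv, one_mul, Real.rpow_neg (norm_nonneg _), Real.rpow_one]
  · exact measurable_inv.aestronglyMeasurable


/-- radial profile -/
noncomputable def bet (δ r : ℝ) : ℝ := max (δ ^ 2 - r ^ 2) 0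

lemma bet_nonneg (δ r : ℝ) : 0 ≤ bet δ r := le_max_right _ _

lemma bet_cont (δ : ℝ) : Continuous (bet δ) := by unfold bet; fun_prop

lemma bet_le {δ : ℝ} (r : ℝ) : bet δ r ≤ δ ^ 2 := max_le (by nlinarith [sq_nonneg r]) (sq_nonneg _)

lemma bet_zero {δ r : ℝ} (hδ : 0 < δ) (h : δ ≤ r) : bet δ r = 0 := by
  unfold bet
  exact max_eq_right (by nlinarith)

open MeasureTheory in
lemma bet_int {δ c : ℝ} (hδ : 0 < δ) (hc : 0 ≤ c) {k : ℕ} (hk : k ≠ 0) :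
    ∫ r in Set.Ioi c, r * bet δ r ^ k = bet δ c ^ (k + 1) / (2 * (k + 1)) := by
  rcases le_total δ c with h | h
  · rw [bet_zero hδ h, setIntegral_congr_fun (g := fun _ => (0:ℝ)) measurableSet_Ioi]
    · simp
    · intro r hr
      have : δ ≤ r := h.trans (le_of_lt hr)
      simp [bet_zero hδ this, hk]
  · have h1 : ∫ r in Set.Ioi c, r * bet δ r ^ k = ∫ r in Set.Ioc c δ, r * bet δ r ^ k := by
      refine (setIntegral_eq_of_subset_of_forall_sdiff_eq_zero measurableSet_Ioi
        Set.Ioc_subset_Ioi_self ?_)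
      intro r hr
      have hr1 : c < r := hr.1
      have : δ ≤ r := by
        by_contra! hcon
        exact hr.2 ⟨hr1, hcon.le⟩
      simp [bet_zero hδ this, hk]
    rw [h1, ← intervalIntegral.integral_of_le h]
    have h2 : ∀ r ∈ Set.uIcc c δ, HasDerivAt
        (fun r : ℝ => -(δ ^ 2 - r ^ 2) ^ (k + 1) / (2 * (k + 1))) (r * (δ ^ 2 - r ^ 2) ^ k) r := by
      intro r _
      have h3 : HasDerivAt (fun r : ℝ => δ ^ 2 - r ^ 2) (-(2 * r)) r := by
        simpa using (hasDerivAt_pow 2 r).const_sub (δ ^ 2)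
      have h4 := ((h3.pow (k + 1)).neg.div_const (2 * ((k : ℝ) + 1)))
      refine h4.congr_deriv ?_
      have : (k : ℝ) + 1 ≠ 0 := by positivity
      simp only [Nat.add_sub_cancel]
      push_cast
      field_simp
    have h5 := intervalIntegral.integral_eq_sub_of_hasDerivAt h2
      (Continuous.intervalIntegrable (by fun_prop) _ _)
    have h6 : ∫ r in c..δ, r * bet δ r ^ k = ∫ r in c..δ, r * (δ ^ 2 - r ^ 2) ^ k := by
      refine intervalIntegral.integral_congr fun r hr => ?_
      rw [Set.uIcc_of_le h] at hr
      have : bet δ r = δ ^ 2 - r ^ 2 := max_eq_left (by nlinarith [hr.1, hr.2])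
      simp only [this]
    have h7 : bet δ c = δ ^ 2 - c ^ 2 := max_eq_left (by nlinarith)
    rw [h6, h5, h7]
    simp
    ring

noncomputable def AA (δ : ℝ) : ℝ := 3 / (Real.pi * δ ^ 6)

noncomputable def aF (δ : ℝ) (s : ℂ) : ℝ := AA δ * bet δ ‖s‖ ^ 2

noncomputable def bF (δ : ℝ) (s : ℂ) : ℂ := s * ((-2 * AA δ * bet δ ‖s‖ : ℝ) : ℂ)

lemma AA_pos {δ : ℝ} (hδ : 0 < δ) : 0 < AA δ := by unfold AA; positivity

lemma bF_cont (δ : ℝ) : Continuous (bF δ) := by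
  unfold bF
  have := bet_cont δ
  fun_prop

lemma aF_cont (δ : ℝ) : Continuous (aF δ) := by
  unfold aF
  have := bet_cont δ
  fun_prop

lemma bF_zero {δ : ℝ} (hδ : 0 < δ) {s : ℂ} (h : δ ≤ ‖s‖) : bF δ s = 0 := by
  simp [bF, bet_zero hδ h]

lemma aF_zero {δ : ℝ} (hδ : 0 < δ) {s : ℂ} (h : δ ≤ ‖s‖) : aF δ s = 0 := by
  simp [aF, bet_zero hδ h]

lemma bF_supp {δ : ℝ} (hδ : 0 < δ) : HasCompactSupport (bF δ) :=
  HasCompactSupport.intro (isCompact_closedBall (0:ℂ) δ) fun s hs => by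
    apply bF_zero hδ
    simp at hs
    exact hs.le

lemma aF_supp {δ : ℝ} (hδ : 0 < δ) : HasCompactSupport (aF δ) :=
  HasCompactSupport.intro (isCompact_closedBall (0:ℂ) δ) fun s hs => by
    apply aF_zero hδ
    simp at hs
    exact hs.le

lemma vol_ball_real (c : ℂ) {r : ℝ} (hr : 0 ≤ r) :
    MeasureTheory.volume.real (ball c r) = Real.pi * r ^ 2 := by
  rw [MeasureTheory.Measure.real, Complex.volume_ball]
  simp [hr]
  ring

open MeasureTheory in
lemma aF_int {δ : ℝ} (hδ : 0 < δ) : ∫ s, aF δ s = 1 := by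
  have := integral_fun_norm_addHaar (volume : Measure ℂ) (fun y => AA δ * bet δ y ^ 2)
  unfold aF
  rw [this, vol_ball_real 0 zero_le_one]
  have h2 : ∀ y : ℝ, y ^ (Module.finrank ℝ ℂ - 1) • (AA δ * bet δ y ^ 2)
      = AA δ * (y * bet δ y ^ 2) := by
    intro y
    simp
    ring
  simp only [h2]
  rw [integral_const_mul, bet_int hδ le_rfl two_ne_zero]
  have h3 : bet δ 0 = δ ^ 2 := by unfold bet; simp; positivity
  rw [h3, AA]
  have := Real.pi_pos
  simp
  field_simp
  norm_num

open MeasureTheory in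
lemma bF_conv {δ : ℝ} (hδ : 0 < δ) (w : ℂ) :
    ∫ t, (w - t)⁻¹ * bF δ t = Real.pi * aF δ w := by
  have e1 : ∀ t, (w - t)⁻¹ * bF δ t = t * ((-2 * AA δ * bet δ ‖t‖ : ℝ) : ℂ) * (w - t)⁻¹ := by
    intro t; unfold bF; ring
  have hi : Integrable fun t => (w - t)⁻¹ * bF δ t := by
    have h1 := (HasCompactSupport.convolutionExists_left (ContinuousLinearMap.mul ℂ ℂ)
      (μ := volume) (bF_supp hδ) (bF_cont δ) locInt_inv) w
    refine h1.congr (Eventually.of_forall fun t => ?_)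
    simp only [ContinuousLinearMap.mul_apply']
    ring
  simp only [e1] at hi ⊢
  have hm : Measurable fun t : ℂ => t * ((-2 * AA δ * bet δ ‖t‖ : ℝ) : ℂ) * (w - t)⁻¹ := by
    have := (bet_cont δ).measurable
    fun_prop
  rw [polar_circle (β := fun r => ((-2 * AA δ * bet δ r : ℝ) : ℂ)) (h := fun t => (w - t)⁻¹) hm hi]
  have h1 : ∀ r : ℝ, 0 < r → r ≠ ‖w‖ →
      (r:ℂ) * (((-2 * AA δ * bet δ r : ℝ) : ℂ) * (-Complex.I * ∮ s in C(0, r), (w - s)⁻¹)) =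
        (Set.Ioi ‖w‖).indicator (fun r : ℝ => ((4 * Real.pi * AA δ * (r * bet δ r ^ 1) : ℝ) : ℂ)) r := by
    intro r hr hrw
    rcases lt_or_gt_of_ne hrw with h | h
    · rw [Set.indicator_of_notMem (by simp [h.le])]
      have : ∮ s in C(0, r), (w - s)⁻¹ = 0 := by
        have hne : ∀ s ∈ closedBall (0:ℂ) r, w - s ≠ 0 := by
          intro s hs h0
          rw [sub_eq_zero] at h0
          rw [← h0] at hs
          simp at hs
          linarith
        refine Complex.circleIntegral_eq_zero_of_differentiable_on_off_countable hr.le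
          Set.countable_empty ?_ ?_
        · exact ContinuousOn.inv₀ (by fun_prop) hne
        · intro s hs
          exact DifferentiableAt.inv (by fun_prop) (hne s (ball_subset_closedBall hs.1))
      rw [this]
      simp
    · rw [Set.indicator_of_mem (by exact h)]
      have h2 : ∮ s in C(0, r), (w - s)⁻¹ = -(2 * Real.pi * Complex.I) := by
        rw [← circleIntegral.integral_sub_inv_of_mem_ball (c := 0) (w := w) (R := r) (by simpa using h)]
        simp only [circleIntegral]
        rw [← intervalIntegral.integral_neg]
        congr 1
        ext θ
        rw [← smul_neg, ← inv_neg, neg_sub]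
      rw [h2]
      push_cast
      linear_combination (-4 * Real.pi * AA δ * r * bet δ r) * Complex.I_mul_I
  have h2 : ∀ᵐ r : ℝ, r ≠ ‖w‖ := by
    rw [ae_iff]
    simp
  rw [setIntegral_congr_ae (g := (Set.Ioi ‖w‖).indicator
    (fun r : ℝ => ((4 * Real.pi * AA δ * (r * bet δ r ^ 1) : ℝ) : ℂ))) measurableSet_Ioi
    (h2.mono fun r hr hr0 => h1 r hr0 hr)]
  rw [setIntegral_indicator measurableSet_Ioi, Set.Ioi_inter_Ioi, max_eq_right (norm_nonneg w)]
  rw [integral_complex_ofReal, integral_const_mul, bet_int hδ (norm_nonneg w) one_ne_zero, aF]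
  push_cast
  ring


lemma bF_norm_le {δ : ℝ} (hδ : 0 < δ) (s : ℂ) : ‖bF δ s‖ ≤ 2 * AA δ * δ ^ 3 := by
  have hA := AA_pos hδ
  rcases le_total δ ‖s‖ with h | h
  · rw [bF_zero hδ h, norm_zero]; positivity
  · have h1 := bet_nonneg δ ‖s‖
    have h2 := bet_le (δ := δ) ‖s‖
    rw [bF, norm_mul, Complex.norm_real, Real.norm_eq_abs, abs_mul, abs_of_nonneg h1, abs_mul,
      abs_of_pos hA]
    have : |(-2:ℝ)| = 2 := by norm_num
    rw [this]
    calc ‖s‖ * (2 * AA δ * bet δ ‖s‖) ≤ δ * (2 * AA δ * δ ^ 2) := by gcongr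
      _ = _ := by ring

open MeasureTheory in
lemma bF_hol {δ : ℝ} (hδ : 0 < δ) {h : ℂ → ℂ} (hc : Continuous h)
    (hd : DifferentiableOn ℂ h (ball 0 δ)) : ∫ s, bF δ s * h s = 0 := by
  have hcc : Continuous fun s => bF δ s * h s := (bF_cont δ).mul hc
  have hi : Integrable fun s => bF δ s * h s :=
    hcc.integrable_of_hasCompactSupport (bF_supp hδ).mul_right
  have := polar_circle (β := fun r => ((-2 * AA δ * bet δ r : ℝ) : ℂ)) (h := h) hcc.measurable hi
  unfold bF
  rw [this]
  refine setIntegral_eq_zero_of_forall_eq_zero fun r hr => ?_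
  have hr' : 0 < r := hr
  rcases le_or_gt δ r with h1 | h1
  · simp [bet_zero hδ h1]
  · have : ∮ s in C(0, r), h s = 0 := by
      refine Complex.circleIntegral_eq_zero_of_differentiable_on_off_countable hr'.le
          Set.countable_empty hc.continuousOn ?_
      intro s hs
      exact hd.differentiableAt (isOpen_ball.mem_nhds (ball_subset_ball h1.le hs.1))
    rw [this]
    simp

open MeasureTheory Convolution in
lemma cauchy_pompeiu {f : ℂ → ℂ} (hf : Continuous f) (hfs : HasCompactSupport f) {δ η : ℝ}
    (hδ : 0 < δ) (hη : ∀ x y, ‖x - y‖ ≤ δ → ‖f x - f y‖ ≤ η) :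
    ∃ Ψ : ℂ → ℂ, Continuous Ψ ∧ HasCompactSupport Ψ ∧ (∀ t, ‖Ψ t‖ ≤ 6 * η / δ) ∧
      (∀ t, DifferentiableOn ℂ f (ball t δ) → Ψ t = 0) ∧
      ∀ z, ‖f z - (1 / Real.pi : ℂ) * ∫ t, (z - t)⁻¹ * Ψ t‖ ≤ η := by
  have hη0 : 0 ≤ η := by simpa using hη 0 0 (by simpa using hδ.le)
  have hA := AA_pos hδ
  set L := ContinuousLinearMap.mul ℂ ℂ
  have hfl : LocallyIntegrable f := hf.locallyIntegrable
  have hΨ : ∀ t, (bF δ ⋆[L, volume] f) t = ∫ s, bF δ s * f (t - s) := fun t => rfl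
  refine ⟨bF δ ⋆[L, volume] f, ?_, ?_, ?_, ?_, ?_⟩
  · exact (bF_supp hδ).continuous_convolution_left L (bF_cont δ) hfl
  · exact (bF_supp hδ).convolution L hfs
  · intro t
    have h0 : ∫ s, bF δ s * (fun _ => f t) s = 0 :=
      bF_hol hδ continuous_const (differentiableOn_const _)
    have hi1 : Integrable fun s => bF δ s * f (t - s) :=
      Continuous.integrable_of_hasCompactSupport ((bF_cont δ).mul (by fun_prop))
        (bF_supp hδ).mul_right
    have hi2 : Integrable fun s => bF δ s * (fun _ => f t) s :=
      Continuous.integrable_of_hasCompactSupport ((bF_cont δ).mul (by fun_prop))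
        (bF_supp hδ).mul_right
    rw [hΨ, ← sub_zero (∫ s, bF δ s * f (t - s)), ← h0, ← integral_sub hi1 hi2]
    have h1 : ∫ s, (bF δ s * f (t - s) - bF δ s * (fun _ => f t) s) =
        ∫ s in ball 0 δ, (bF δ s * f (t - s) - bF δ s * (fun _ => f t) s) := by
      refine (setIntegral_eq_integral_of_forall_compl_eq_zero fun s hs => ?_).symm
      have : δ ≤ ‖s‖ := by simpa using hs
      simp [bF_zero hδ this]
    rw [h1]
    refine (norm_setIntegral_le_of_norm_le_const (C := 2 * AA δ * δ ^ 3 * η) ?_ ?_).trans ?_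
    · exact measure_ball_lt_top
    · intro s hs
      have hs' : ‖s‖ < δ := by simpa using hs
      rw [← mul_sub, norm_mul]
      gcongr
      · exact bF_norm_le hδ s
      · apply hη
        simpa using hs'.le
    · rw [vol_ball_real 0 hδ.le, AA]
      have := Real.pi_pos
      apply le_of_eq
      field_simp
      ring
  · intro t ht
    rw [hΨ]
    refine bF_hol hδ (h := fun s => f (t - s)) (by fun_prop) ?_
    refine ht.comp (f := fun s => t - s) (by fun_prop) ?_
    intro s hs
    simpa using hs
  · intro z
    have hk := locInt_inv
    have assoc : (((fun z : ℂ => z⁻¹) ⋆[L, volume] bF δ) ⋆[L, volume] f) z =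
        ((fun z : ℂ => z⁻¹) ⋆[L, volume] (bF δ ⋆[L, volume] f)) z := by
      refine convolution_assoc L L L L (fun x y z => mul_assoc x y z) ?_ ?_ ?_ ?_ ?_ ?_
      · exact measurable_inv.aestronglyMeasurable
      · exact (bF_cont δ).aestronglyMeasurable
      · exact hf.aestronglyMeasurable
      · exact Eventually.of_forall
          ((bF_supp hδ).convolutionExists_right L hk (bF_cont δ))
      · exact Eventually.of_forall ((bF_supp hδ).norm.convolutionExists_left _ (bF_cont δ).norm
          hf.norm.locallyIntegrable)
      · refine HasCompactSupport.convolutionExists_right _ ?_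
          (fun x => let ⟨s, hs, hi⟩ := hk x; ⟨s, hs, hi.norm⟩) ?_ z
        · exact (bF_supp hδ).norm.convolution _ hfs.norm
        · exact (bF_supp hδ).norm.continuous_convolution_left _ (bF_cont δ).norm
            hf.norm.locallyIntegrable
    have h1 : ((fun z : ℂ => z⁻¹) ⋆[L, volume] (bF δ ⋆[L, volume] f)) z =
        ∫ t, (z - t)⁻¹ * (bF δ ⋆[L, volume] f) t := convolution_mul_swap
    have h2 : ((fun z : ℂ => z⁻¹) ⋆[L, volume] bF δ) = fun w => (Real.pi : ℂ) * (aF δ w : ℂ) := by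
      ext w
      rw [← bF_conv hδ w]
      exact convolution_mul_swap
    rw [h2] at assoc
    rw [← h1, ← assoc]
    have h3 : ((fun w => (Real.pi : ℂ) * (aF δ w : ℂ)) ⋆[L, volume] f) z =
        Real.pi * ∫ s, (aF δ s : ℂ) * f (z - s) := by
      rw [← integral_const_mul]
      refine integral_congr_ae (Eventually.of_forall fun s => ?_)
      simp only [L, ContinuousLinearMap.mul_apply']
      ring
    rw [h3]
    have hpi : (Real.pi : ℂ) ≠ 0 := by exact_mod_cast Real.pi_ne_zero
    rw [← mul_assoc, one_div, inv_mul_cancel₀ hpi, one_mul]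
    have hac : Continuous fun s => (aF δ s : ℂ) := Complex.continuous_ofReal.comp (aF_cont δ)
    have has : HasCompactSupport fun s => (aF δ s : ℂ) :=
      (aF_supp hδ).comp_left (g := fun x : ℝ => (x : ℂ)) Complex.ofReal_zero
    have hi1 : Integrable fun s => (aF δ s : ℂ) * f (z - s) :=
      Continuous.integrable_of_hasCompactSupport (hac.mul (by fun_prop)) has.mul_right
    have hi2 : Integrable fun s => (aF δ s : ℂ) * f z :=
      Continuous.integrable_of_hasCompactSupport (hac.mul (by fun_prop)) has.mul_right
    have h4 : f z = ∫ s, (aF δ s : ℂ) * f z := by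
      rw [integral_mul_const, integral_complex_ofReal, aF_int hδ]
      simp
    conv_lhs => rw [h4]
    rw [← integral_sub hi2 hi1]
    have hi3 : Integrable fun s => aF δ s * η :=
      ((aF_cont δ).integrable_of_hasCompactSupport (aF_supp hδ)).mul_const _
    refine (norm_integral_le_of_norm_le hi3 (Eventually.of_forall fun s => ?_)).trans ?_
    · rw [← mul_sub, norm_mul, Complex.norm_real]
      have ha0 : 0 ≤ aF δ s := by unfold aF; positivity
      rw [Real.norm_eq_abs, abs_of_nonneg ha0]
      rcases le_total δ ‖s‖ with h | h
      · simp [aF_zero hδ h]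
      · gcongr
        apply hη
        simpa using h
    · rw [integral_mul_const, aF_int hδ, one_mul]


open MeasureTheory in
lemma W_int {r : ℝ} (hr : 0 < r) :
    Integrable (fun w : ℂ => r ^ 2 / (‖w‖ * (r ^ 2 + ‖w‖ ^ 2))) ∧
      ∫ w : ℂ, r ^ 2 / (‖w‖ * (r ^ 2 + ‖w‖ ^ 2)) = Real.pi ^ 2 * r := by
  have e1 : ∀ y ∈ Set.Ioi (0:ℝ), y ^ (Module.finrank ℝ ℂ - 1) • (r ^ 2 / (y * (r ^ 2 + y ^ 2))) =
      (1 + (r⁻¹ * y) ^ 2)⁻¹ := by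
    intro y hy
    have hy' : 0 < y := hy
    simp
    field_simp
  have h1 : IntegrableOn (fun y : ℝ => (1 + (r⁻¹ * y) ^ 2)⁻¹) (Set.Ioi 0) :=
    (integrable_inv_one_add_sq.comp_mul_left' (inv_ne_zero hr.ne')).integrableOn
  constructor
  · have := (integrable_fun_norm_addHaar (volume : Measure ℂ)
      (f := fun y : ℝ => r ^ 2 / (y * (r ^ 2 + y ^ 2)))).2
      (h1.congr_fun (fun y hy => (e1 y hy).symm) measurableSet_Ioi)
    exact this
  · have := integral_fun_norm_addHaar (volume : Measure ℂ)
      (fun y : ℝ => r ^ 2 / (y * (r ^ 2 + y ^ 2)))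
    rw [this, setIntegral_congr_fun measurableSet_Ioi e1, vol_ball_real 0 zero_le_one,
      integral_comp_mul_left_Ioi (fun y : ℝ => (1 + y ^ 2)⁻¹) 0 (inv_pos.2 hr), mul_zero,
      integral_Ioi_inv_one_add_sq]
    simp
    ring

open MeasureTheory in
lemma mergelyan_step {K : Set ℂ} [CompactSpace K] (hKc : IsConnected Kᶜ) {f : ℂ → ℂ}
    (hf : Continuous f) (hfs : HasCompactSupport f)
    (hfd : DifferentiableOn ℂ f (interior K)) {δ η : ℝ}
    (hδ : 0 < δ) (hη : ∀ x y, ‖x - y‖ ≤ δ → ‖f x - f y‖ ≤ η) :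
    ∃ G, PA K G ∧ ∀ z ∈ K, ‖G z - f z‖ ≤ 200000000 * η := by
  have hη0 : 0 ≤ η := by simpa using hη 0 0 (by simpa using hδ.le)
  obtain ⟨Ψ, hΨc, hΨs, hΨb, hΨ0, hΨ⟩ := cauchy_pompeiu hf hfs hδ hη
  have hr : 0 < 2 * δ := by positivity
  have : Nonempty (Kᶜ : Set ℂ) := hKc.nonempty.to_subtype
  obtain ⟨e, he⟩ := TopologicalSpace.exists_dense_seq (Kᶜ : Set ℂ)
  -- covering
  have hcov : tsupport Ψ ⊆ ⋃ n, ball ((e n : ℂ)) (2 * δ) := by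
    intro t ht
    obtain ⟨t', ht', htt⟩ := Metric.mem_closure_iff.1 ht δ hδ
    have h1 : ¬ ball t' δ ⊆ K := fun h =>
      ht' (hΨ0 t' (hfd.mono (interior_maximal h isOpen_ball)))
    obtain ⟨c, hc1, hc2⟩ := Set.not_subset.1 h1
    have h2 : dist c t < 2 * δ := by
      have h3 : dist c t' < δ := hc1
      have := dist_triangle c t' t
      rw [dist_comm t t'] at htt
      linarith
    have hU : IsOpen {x : (Kᶜ : Set ℂ) | dist (x : ℂ) t < 2 * δ} :=
      isOpen_lt (by fun_prop) continuous_const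
    obtain ⟨n, hn⟩ := he.exists_mem_open hU ⟨⟨c, hc2⟩, h2⟩
    refine Set.mem_iUnion.2 ⟨n, ?_⟩
    rw [mem_ball, dist_comm]
    exact hn
  obtain ⟨T, hT⟩ := IsCompact.elim_finite_subcover hΨs _ (fun n => isOpen_ball) hcov
  set N := T.sup id with hN
  set e' : ℕ → ℂ := fun n => e n with he'
  set J : ℂ → ℕ := fun t => SimpleFunc.nearestPtInd e' N t with hJ
  have hJN : ∀ t, J t ∈ Finset.range (N + 1) := fun t =>
    Finset.mem_range.2 (Nat.lt_succ_of_le (SimpleFunc.nearestPtInd_le e' N t))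
  have hJm : ∀ k, MeasurableSet {t | J t = k} := fun k =>
    (SimpleFunc.nearestPtInd e' N).measurableSet_fiber k
  have hJd : ∀ t, Ψ t ≠ 0 → ‖t - e' (J t)‖ ≤ 2 * δ := by
    intro t ht
    have h1 := hT (subset_tsupport _ ht)
    simp only [Set.mem_iUnion] at h1
    obtain ⟨n, hn, hnt⟩ := h1
    have h2 := SimpleFunc.edist_nearestPt_le e' t (k := n) (N := N) (Finset.le_sup (f := id) hn)
    have h3 : SimpleFunc.nearestPt e' N t = e' (J t) := rfl
    rw [h3, edist_dist, edist_dist, ENNReal.ofReal_le_ofReal_iff dist_nonneg] at h2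
    rw [← dist_eq_norm, dist_comm]
    rw [mem_ball, dist_comm] at hnt
    exact h2.trans hnt.le
  choose g m hgPA hg using fun n => exists_Q hKc (c := e' n) (e n).2 hr
  set ind : ℕ → ℂ → ℂ := fun k t => {t | J t = k}.indicator Ψ t with hind
  have hΨi : Integrable Ψ := hΨc.integrable_of_hasCompactSupport hΨs
  have hΨi2 : ∀ a : ℂ, Integrable fun t => (t - a) * Ψ t := fun a =>
    Continuous.integrable_of_hasCompactSupport (by fun_prop) hΨs.mul_left
  have hi1 : ∀ k, Integrable (ind k) := fun k => hΨi.indicator (hJm k)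
  have hi2 : ∀ k (a : ℂ), Integrable fun t => (t - a) * ind k t := by
    intro k a
    refine ((hΨi2 a).indicator (hJm k)).congr (Eventually.of_forall fun t => ?_)
    simp only [hind, Set.indicator_apply]
    split_ifs <;> simp
  refine ⟨fun z => (1 / Real.pi : ℂ) * ∑ k ∈ Finset.range (N + 1),
    (g k z * (∫ t, ind k t) + g k z ^ 2 * ∫ t, (t - m k) * ind k t), ?_, ?_⟩
  · refine (PA.const K _).mul (PA.sum _ fun k _ => ?_)
    exact ((hgPA k).mul (PA.const K _)).add (((hgPA k).pow 2).mul (PA.const K _))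
  intro z hz
  have hi3 : ∀ k, Integrable fun t => (g k z + (t - m k) * g k z ^ 2) * ind k t := by
    intro k
    refine (((hi1 k).const_mul (g k z)).add ((hi2 k (m k)).const_mul (g k z ^ 2))).congr
      (Eventually.of_forall fun t => ?_)
    simp only [Pi.add_apply]
    ring
  have hsum : ∑ k ∈ Finset.range (N + 1),
      (g k z * (∫ t, ind k t) + g k z ^ 2 * ∫ t, (t - m k) * ind k t) =
      ∫ t, (g (J t) z + (t - m (J t)) * g (J t) z ^ 2) * Ψ t := by
    have h1 : ∀ k, (g k z * (∫ t, ind k t) + g k z ^ 2 * ∫ t, (t - m k) * ind k t) =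
        ∫ t, (g k z + (t - m k) * g k z ^ 2) * ind k t := by
      intro k
      rw [← integral_const_mul, ← integral_const_mul, ← integral_add ((hi1 k).const_mul _)
        ((hi2 k (m k)).const_mul _)]
      refine integral_congr_ae (Eventually.of_forall fun t => ?_)
      simp only
      ring
    simp only [h1]
    rw [← integral_finsetSum _ fun k _ => hi3 k]
    refine integral_congr_ae (Eventually.of_forall fun t => ?_)
    simp only
    rw [Finset.sum_eq_single_of_mem (J t) (hJN t)]
    · simp [hind]
    · intro k _ hk
      have : ind k t = 0 := by
        simp only [hind]
        exact Set.indicator_of_notMem (s := {t | J t = k}) (fun h => hk (Eq.symm h)) _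
      rw [this, mul_zero]
  have hI1 : Integrable fun t => (g (J t) z + (t - m (J t)) * g (J t) z ^ 2) * Ψ t := by
    refine (integrable_finsetSum (Finset.range (N + 1)) fun k _ => hi3 k).congr
      (Eventually.of_forall fun t => ?_)
    simp only
    rw [Finset.sum_eq_single_of_mem (J t) (hJN t)]
    · simp [hind]
    · intro k _ hk
      have : ind k t = 0 := by
        simp only [hind]
        exact Set.indicator_of_notMem (s := {t | J t = k}) (fun h => hk (Eq.symm h)) _
      rw [this, mul_zero]
  have hI2 : Integrable fun t => (z - t)⁻¹ * Ψ t := by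
    have h1 := (HasCompactSupport.convolutionExists_left (ContinuousLinearMap.mul ℂ ℂ)
      (μ := volume) hΨs hΨc locInt_inv) z
    refine h1.congr (Eventually.of_forall fun t => ?_)
    simp only [ContinuousLinearMap.mul_apply']
    ring
  obtain ⟨hW1, hW2⟩ := W_int hr
  have hae : ∀ᵐ t : ℂ, t ≠ z := by
    rw [ae_iff]
    simp
  have hmain : ‖(∫ t, (g (J t) z + (t - m (J t)) * g (J t) z ^ 2) * Ψ t) -
      ∫ t, (z - t)⁻¹ * Ψ t‖ ≤ (3000000 * (6 * η / δ)) * (Real.pi ^ 2 * (2 * δ)) := by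
    rw [← integral_sub hI1 hI2, ← hW2, ← integral_sub_left_eq_self (fun w : ℂ => (2 * δ) ^ 2 / (‖w‖ * ((2 * δ) ^ 2 + ‖w‖ ^ 2))) volume z, ← integral_const_mul]
    refine norm_integral_le_of_norm_le ((hW1.comp_sub_left z).const_mul _) (hae.mono fun t ht => ?_)
    rw [← sub_mul, norm_mul]
    by_cases h0 : Ψ t = 0
    · rw [h0, norm_zero, mul_zero]
      positivity
    · have h1 := hg (J t) t (hJd t h0) z hz ht.symm
      rw [one_div] at h1
      calc _ ≤ (3000000 * ((2 * δ) ^ 2 / (‖z - t‖ * ((2 * δ) ^ 2 + ‖z - t‖ ^ 2)))) * (6 * η / δ) := by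
            gcongr
            exact hΨb t
        _ = _ := by ring
  beta_reduce
  rw [hsum]
  set I1 := ∫ t, (g (J t) z + (t - m (J t)) * g (J t) z ^ 2) * Ψ t
  set I2 := ∫ t, (z - t)⁻¹ * Ψ t with hI2'
  have hz2 := hΨ z
  rw [← hI2'] at hz2
  have hsplit : (1 / Real.pi : ℂ) * I1 - f z =
      (1 / Real.pi : ℂ) * (I1 - I2) - (f z - (1 / Real.pi : ℂ) * I2) := by ring
  rw [hsplit]
  refine (norm_sub_le _ _).trans ?_
  have hpi := Real.pi_pos
  have hn : ‖(1 / Real.pi : ℂ)‖ = 1 / Real.pi := by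
    rw [norm_div, norm_one, Complex.norm_real, Real.norm_eq_abs, abs_of_pos hpi]
  rw [norm_mul, hn]
  have h9 : 1 / Real.pi * ‖I1 - I2‖ ≤ 1 / Real.pi *
      ((3000000 * (6 * η / δ)) * (Real.pi ^ 2 * (2 * δ))) := by gcongr
  have h10 : 1 / Real.pi * ((3000000 * (6 * η / δ)) * (Real.pi ^ 2 * (2 * δ))) =
      36000000 * η * Real.pi := by
    field_simp
    ring
  have h11 : 36000000 * η * Real.pi ≤ 36000000 * η * 4 := by
    gcongr
    exact Real.pi_le_four
  linarith

theorem mergelyan (K : Set ℂ) (hK : IsCompact K) (hKc : IsConnected Kᶜ) (f : ℂ → ℂ)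
    (hf : ContinuousOn f K) (hfd : DifferentiableOn ℂ f (interior K)) (ε : ℝ) (hε : 0 < ε) :
    ∃ p : Polynomial ℂ, ∀ z ∈ K, ‖p.eval z - f z‖ ≤ ε := by
  have : CompactSpace K := isCompact_iff_compactSpace.1 hK
  obtain ⟨F, hF⟩ := ContinuousMap.exists_restrict_eq hK.isClosed
    (⟨K.domRestrict f, hf.domRestrict⟩ : C(K, ℂ))
  have hFf : ∀ z ∈ K, F z = f z := fun z hz => by
    have := congrArg (fun u : C(K, ℂ) => u ⟨z, hz⟩) hF
    simpa using this
  obtain ⟨χ, hχ1, -, hχs, -⟩ := exists_continuous_one_zero_of_isCompact hK isClosed_empty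
    (Set.disjoint_empty K)
  set G : ℂ → ℂ := fun z => (χ z : ℂ) * F z with hG
  have hGc : Continuous G := by
    simp only [hG]
    fun_prop
  have hGs : HasCompactSupport G :=
    (hχs.comp_left (g := fun x : ℝ => (x : ℂ)) Complex.ofReal_zero).mul_right
  have hGf : ∀ z ∈ K, G z = f z := fun z hz => by
    simp only [hG]
    rw [hFf z hz, hχ1 hz]
    simp
  have huc := hGc.uniformContinuous_of_tendsto_cocompact (x := 0) hGs.is_zero_at_infty
  set η := ε / 400000000 with hη
  have hη0 : 0 < η := by positivity
  obtain ⟨δ, hδ, h1⟩ := Metric.uniformContinuous_iff.1 huc η hη0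
  obtain ⟨H, hH, hH2⟩ := mergelyan_step hKc hGc hGs
    (hfd.congr fun z hz => hGf z (interior_subset hz)) (half_pos hδ) (η := η) (by
      intro x y hxy
      rw [← dist_eq_norm] at hxy ⊢
      exact (h1 (by linarith)).le)
  obtain ⟨p, hp⟩ := hH.exists_poly (ε / 2) (by positivity)
  refine ⟨p, fun z hz => ?_⟩
  have h2 := hH2 z hz
  rw [hGf z hz] at h2
  have h3 := hp z hz
  have : p.eval z - f z = (p.eval z - H z) + (H z - f z) := by ring
  rw [this]
  refine (norm_add_le _ _).trans ?_
  linarith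


lemma exists_series (c : ℕ → ℂ) (hc : ∀ n, ‖c n‖ ≤ 1) :
    ∃ f : ℂ → ℂ, DifferentiableOn ℂ f (ball 0 1) ∧
      ∀ k, iteratedDeriv k f 0 / (Nat.factorial k) = c k := by
  let p := FormalMultilinearSeries.ofScalars ℂ c
  have hr : (1 : ENNReal) ≤ p.radius := by
    have := p.le_radius_of_bound (r := 1) 1 (fun n => by
      simpa [p, FormalMultilinearSeries.ofScalars_norm] using hc n)
    simpa using this
  have hp := p.hasFPowerSeriesOnBall (lt_of_lt_of_le one_pos hr)
  refine ⟨p.sum, ?_, ?_⟩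
  · have h1 := hp.differentiableOn
    refine h1.mono ?_
    intro z hz
    have : z ∈ Metric.eball (0:ℂ) 1 := by
      simp only [mem_ball, dist_zero_right] at hz
      rw [Metric.mem_eball, edist_zero_right]
      rw [← ofReal_norm]
      exact ENNReal.ofReal_lt_one.2 hz
    exact Metric.eball_subset_eball hr this
  · intro k
    have h1 := (hp.analyticAt).hasFPowerSeriesAt
    have h2 := h1.eq_formalMultilinearSeries hp.hasFPowerSeriesAt
    have h3 := FormalMultilinearSeries.ofScalars_series_injective ℂ ℂ h2
    exact congrFun h3 k

lemma poly_iteratedDeriv (p : Polynomial ℂ) (k : ℕ) :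
    iteratedDeriv k (fun z => p.eval z) = fun z => (Polynomial.derivative^[k] p).eval z := by
  induction k with
  | zero => simp
  | succ k ih =>
    rw [iteratedDeriv_succ, ih]
    ext z
    rw [Polynomial.deriv, Function.iterate_succ_apply']

lemma poly_coeff_le (p : Polynomial ℂ) (M : ℝ)
    (h : ∀ z ∈ closedBall (0:ℂ) 1, ‖p.eval z‖ ≤ M) (j : ℕ) : ‖p.coeff j‖ ≤ M := by
  have h1 := Complex.norm_iteratedDeriv_le_of_forall_mem_sphere_norm_le (c := 0) (R := 1) (C := M)
    (f := fun z => p.eval z) j one_pos p.differentiable.diffContOnCl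
    (fun z hz => h z (sphere_subset_closedBall hz))
  rw [poly_iteratedDeriv] at h1
  beta_reduce at h1
  rw [← Polynomial.coeff_zero_eq_eval_zero,
    Polynomial.coeff_iterate_derivative] at h1
  simp only [zero_add, Nat.descFactorial_self, one_pow, div_one, nsmul_eq_mul, norm_mul,
    Complex.norm_natCast] at h1
  exact le_of_mul_le_mul_left h1 (by positivity)

/-- The inductive step. -/
lemma univ_step (β : ℕ → ℂ) (K : Set ℂ) (hK : IsCompact K) (σ τ : ℝ) (hσ : 0 < σ) (hστ : σ < τ)
    (hτ : τ < 1)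
    (hw : ∀ᶠ n : ℕ in atTop, ∃ p : Polynomial ℂ, p.natDegree ≤ n ∧
      (∀ z ∈ closedBall (0:ℂ) 1, ‖p.eval z‖ ≤ σ ^ n) ∧ ∀ z ∈ K, ‖1 - p.eval z‖ ≤ σ ^ n)
    (hβ : ∃ᶠ n : ℕ in atTop, τ ^ n ≤ ‖β n‖ ∧ ‖β n‖ ≤ (τ ^ n)⁻¹)
    (Q h : Polynomial ℂ) (N : ℕ) (hQN : Q.natDegree ≤ N) (hQ1 : ∀ i, ‖Q.coeff i‖ ≤ 1)
    (ε : ℝ) (hε : 0 < ε) :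
    ∃ n > N, ∃ Q' : Polynomial ℂ, Q'.natDegree ≤ n ∧ (∀ i ≤ N, Q'.coeff i = Q.coeff i) ∧
      (∀ i, ‖Q'.coeff i‖ ≤ 1) ∧ ∀ z ∈ K, ‖β n * Q'.eval z - h.eval z‖ ≤ ε := by
  set s := max N h.natDegree with hs
  have hτ0 : 0 < τ := hσ.trans hστ
  -- bound on K
  obtain ⟨R, hR1, hR⟩ : ∃ R : ℝ, 1 ≤ R ∧ ∀ z ∈ closedBall (0:ℂ) 1 ∪ K, ‖z‖ ≤ R := by
    obtain ⟨R, hR⟩ := ((isCompact_closedBall (0:ℂ) 1).union hK).isBounded.exists_norm_le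
    exact ⟨max R 1, le_max_right _ _, fun z hz => (hR z hz).trans (le_max_left _ _)⟩
  have hLc := (isCompact_closedBall (0:ℂ) 1).union hK
  obtain ⟨A₁, hA₁⟩ := (hLc.image Q.continuous).isBounded.exists_norm_le
  obtain ⟨A₂, hA₂⟩ := (hLc.image h.continuous).isBounded.exists_norm_le
  set A := max (max A₁ A₂) 0 with hA
  have hA0 : 0 ≤ A := le_max_right _ _
  have hQA : ∀ z ∈ closedBall (0:ℂ) 1 ∪ K, ‖Q.eval z‖ ≤ A := fun z hz =>
    (hA₁ _ ⟨z, hz, rfl⟩).trans ((le_max_left _ _).trans (le_max_left _ _))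
  have hhA : ∀ z ∈ closedBall (0:ℂ) 1 ∪ K, ‖h.eval z‖ ≤ A := fun z hz =>
    (hA₂ _ ⟨z, hz, rfl⟩).trans ((le_max_right _ _).trans (le_max_left _ _))
  set B : ℝ := 1 + (N + 1) * R ^ N with hB
  have hB0 : 0 ≤ B := by positivity
  have hlim : Tendsto (fun n : ℕ => B * (σ ^ s)⁻¹ * (2 * A) * (σ / τ) ^ n) atTop (𝓝 0) := by
    have := (tendsto_pow_atTop_nhds_zero_of_lt_one (r := σ / τ) (by positivity)
      ((div_lt_one hτ0).2 hστ)).const_mul (B * (σ ^ s)⁻¹ * (2 * A))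
    simpa using this
  have hsmall : ∀ᶠ n : ℕ in atTop, B * (σ ^ s)⁻¹ * (2 * A) * (σ / τ) ^ n < min ε 1 :=
    hlim.eventually (gt_mem_nhds (by positivity))
  have hw' := (tendsto_sub_atTop_nat s).eventually hw
  obtain ⟨n, ⟨hβ1, hβ2⟩, ⟨p, hpd, hp0, hp1⟩, hsm, hn⟩ :=
    (hβ.and_eventually (hw'.and (hsmall.and (eventually_gt_atTop (s + N))))).exists
  have hsn : s ≤ n := by omega
  set T : Polynomial ℂ := ∑ j ∈ Finset.range (N + 1), Polynomial.C (p.coeff j) * Polynomial.X ^ j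
    with hT
  set w := p - T with hwdef
  have hTc : ∀ i, T.coeff i = if i ≤ N then p.coeff i else 0 := by
    intro i
    rw [hT, Polynomial.finsetSum_coeff]
    simp only [Polynomial.coeff_C_mul, Polynomial.coeff_X_pow, mul_ite, mul_one, mul_zero]
    rw [Finset.sum_ite_eq]
    simp
  have hwc : ∀ i ≤ N, w.coeff i = 0 := by
    intro i hi
    simp [hwdef, hTc, hi]
  have hwd : w.natDegree ≤ n - s := by
    rw [Polynomial.natDegree_le_iff_coeff_eq_zero]
    intro i hi
    have : p.coeff i = 0 := Polynomial.coeff_eq_zero_of_natDegree_lt (lt_of_le_of_lt hpd hi)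
    simp [hwdef, hTc, this]
  have hTb : ∀ z ∈ closedBall (0:ℂ) 1 ∪ K, ‖T.eval z‖ ≤ (N + 1) * R ^ N * σ ^ (n - s) := by
    intro z hz
    rw [hT, Polynomial.eval_finsetSum]
    refine (norm_sum_le _ _).trans ?_
    refine (Finset.sum_le_card_nsmul _ _ (R ^ N * σ ^ (n - s)) ?_).trans ?_
    · intro j hj
      have hj' : j ≤ N := Nat.lt_succ_iff.1 (Finset.mem_range.1 hj)
      simp only [Polynomial.eval_mul, Polynomial.eval_C, Polynomial.eval_pow, Polynomial.eval_X,
        norm_mul, norm_pow]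
      rw [mul_comm]
      have h1 : ‖z‖ ^ j ≤ R ^ N :=
        (pow_le_pow_left₀ (norm_nonneg _) (hR z hz) j).trans (pow_le_pow_right₀ hR1 hj')
      have h2 := poly_coeff_le p _ hp0 j
      gcongr
    · simp [mul_assoc]
  have hwD : ∀ z ∈ closedBall (0:ℂ) 1, ‖w.eval z‖ ≤ B * σ ^ (n - s) := by
    intro z hz
    have h1 := hp0 z hz
    have h2 := hTb z (Or.inl hz)
    calc ‖w.eval z‖ = ‖p.eval z - T.eval z‖ := by simp [hwdef]
      _ ≤ ‖p.eval z‖ + ‖T.eval z‖ := norm_sub_le _ _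
      _ ≤ B * σ ^ (n - s) := by rw [hB]; linarith
  have hwK : ∀ z ∈ K, ‖1 - w.eval z‖ ≤ B * σ ^ (n - s) := by
    intro z hz
    have h1 := hp1 z hz
    have h2 := hTb z (Or.inr hz)
    calc ‖1 - w.eval z‖ = ‖(1 - p.eval z) + T.eval z‖ := by
          simp only [hwdef, Polynomial.eval_sub]; ring_nf
      _ ≤ ‖1 - p.eval z‖ + ‖T.eval z‖ := norm_add_le _ _
      _ ≤ B * σ ^ (n - s) := by rw [hB]; linarith
  have hτn : 0 < τ ^ n := by positivity
  have hτn1 : 1 ≤ (τ ^ n)⁻¹ := (one_le_inv₀ hτn).2 (pow_le_one₀ hτ0.le hτ.le)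
  have hβ0 : β n ≠ 0 := norm_pos_iff.1 (hτn.trans_le hβ1)
  have hfin : B * σ ^ (n - s) * (2 * A * (τ ^ n)⁻¹) < min ε 1 := by
    convert hsm using 1
    rw [pow_sub₀ _ hσ.ne' hsn, div_pow]
    field_simp
  set P := w * (Polynomial.C (β n)⁻¹ * h - Q) with hP
  have hPD : ∀ z ∈ closedBall (0:ℂ) 1, ‖P.eval z‖ ≤ 1 := by
    intro z hz
    have h1 := hwD z hz
    have h2 : ‖(β n)⁻¹ * h.eval z - Q.eval z‖ ≤ 2 * A * (τ ^ n)⁻¹ := by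
      refine (norm_sub_le _ _).trans ?_
      have h3 : ‖(β n)⁻¹‖ ≤ (τ ^ n)⁻¹ := by
        rw [norm_inv]; exact inv_anti₀ hτn hβ1
      have h4 := hhA z (Or.inl hz)
      have h5 := hQA z (Or.inl hz)
      rw [norm_mul]
      have h6 : ‖(β n)⁻¹‖ * ‖h.eval z‖ ≤ (τ ^ n)⁻¹ * A := by gcongr
      nlinarith
    have : ‖P.eval z‖ ≤ B * σ ^ (n - s) * (2 * A * (τ ^ n)⁻¹) := by
      simp only [hP, Polynomial.eval_mul, Polynomial.eval_sub, Polynomial.eval_C, norm_mul]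
      exact mul_le_mul h1 h2 (norm_nonneg _) (by positivity)
    exact this.trans (hfin.le.trans (min_le_right _ _))
  have hPc : ∀ i ≤ N, P.coeff i = 0 := by
    intro i hi
    rw [hP, Polynomial.coeff_mul]
    refine Finset.sum_eq_zero fun x hx => ?_
    have : x.1 ≤ i := by
      have := Finset.HasAntidiagonal.mem_antidiagonal.1 hx
      omega
    rw [hwc x.1 (this.trans hi), zero_mul]
  refine ⟨n, by omega, Q + P, ?_, ?_, ?_, ?_⟩
  · refine (Polynomial.natDegree_add_le _ _).trans (max_le (by omega) ?_)
    refine Polynomial.natDegree_mul_le.trans ?_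
    have : (Polynomial.C (β n)⁻¹ * h - Q).natDegree ≤ s := by
      refine (Polynomial.natDegree_sub_le _ _).trans (max_le ?_ (hQN.trans (le_max_left _ _)))
      exact (Polynomial.natDegree_C_mul_le _ _).trans (le_max_right _ _)
    omega
  · intro i hi
    simp [hPc i hi]
  · intro i
    by_cases hi : i ≤ N
    · simpa [hPc i hi] using hQ1 i
    · have : Q.coeff i = 0 := Polynomial.coeff_eq_zero_of_natDegree_lt (by omega)
      simpa [this] using poly_coeff_le P 1 hPD i
  · intro z hz
    have h1 := hwK z hz
    have h2 : ‖β n * Q.eval z - h.eval z‖ ≤ 2 * A * (τ ^ n)⁻¹ := by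
      refine (norm_sub_le _ _).trans ?_
      have h4 := hhA z (Or.inr hz)
      have h5 := hQA z (Or.inr hz)
      rw [norm_mul]
      have h6 : ‖β n‖ * ‖Q.eval z‖ ≤ (τ ^ n)⁻¹ * A := by gcongr
      nlinarith
    have h3 : β n * (Q + P).eval z - h.eval z
        = (1 - w.eval z) * (β n * Q.eval z - h.eval z) := by
      simp only [hP, Polynomial.eval_add, Polynomial.eval_mul, Polynomial.eval_sub,
        Polynomial.eval_C]
      field_simp
      ring
    rw [h3, norm_mul]
    exact (mul_le_mul h1 h2 (norm_nonneg _) (by positivity)).trans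
      (hfin.le.trans (min_le_left _ _))

lemma exists_dense_polys (K : Set ℂ) (hK : IsCompact K) : ∃ h : ℕ → Polynomial ℂ,
    ∀ p : Polynomial ℂ, ∀ ε > 0, ∀ k₀ : ℕ, ∃ k ≥ k₀, ∀ z ∈ K, ‖(h k).eval z - p.eval z‖ ≤ ε := by
  haveI : CompactSpace K := isCompact_iff_compactSpace.1 hK
  let φ : Polynomial ℂ → C(K, ℂ) := fun p => p.toContinuousMapOn K
  obtain ⟨s, hsc, hsd⟩ := TopologicalSpace.exists_countable_dense (Set.range φ)
  have : s.Nonempty := by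
    haveI : Nonempty (Set.range φ) := ⟨⟨φ 0, 0, rfl⟩⟩
    exact hsd.nonempty
  obtain ⟨u, hu⟩ := hsc.exists_eq_range this
  choose g hg using fun n => (u n).2
  refine ⟨fun k => g (Nat.unpair k).1, fun p ε hε k₀ => ?_⟩
  obtain ⟨y, hy, hys⟩ := hsd.exists_dist_lt ⟨φ p, p, rfl⟩ hε
  rw [hu] at hy
  obtain ⟨n, rfl⟩ := hy
  refine ⟨Nat.pair n k₀, Nat.right_le_pair _ _, fun z hz => ?_⟩
  simp only [Nat.unpair_pair]
  have h1 : dist (φ p) (u n : C(K, ℂ)) < ε := hys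
  rw [← hg n] at h1
  have h2 := (ContinuousMap.dist_apply_le_dist (f := φ p) (g := φ (g n)) ⟨z, hz⟩).trans h1.le
  rw [dist_comm, dist_eq_norm] at h2
  exact h2

lemma univ_exists (β : ℕ → ℂ) (K : Set ℂ) (hK : IsCompact K) (σ τ : ℝ) (hσ : 0 < σ) (hστ : σ < τ)
    (hτ : τ < 1)
    (hw : ∀ᶠ n : ℕ in atTop, ∃ p : Polynomial ℂ, p.natDegree ≤ n ∧
      (∀ z ∈ closedBall (0:ℂ) 1, ‖p.eval z‖ ≤ σ ^ n) ∧ ∀ z ∈ K, ‖1 - p.eval z‖ ≤ σ ^ n)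
    (hβ : ∃ᶠ n : ℕ in atTop, τ ^ n ≤ ‖β n‖ ∧ ‖β n‖ ≤ (τ ^ n)⁻¹) :
    ∃ f : ℂ → ℂ, DifferentiableOn ℂ f (ball 0 1) ∧ ∀ p : Polynomial ℂ, ∀ ε > 0,
      ∃ n ≥ 1, ∀ z ∈ K, ‖β n * (∑ k ∈ Finset.range (n + 1),
        (iteratedDeriv k f 0 / (Nat.factorial k)) * (z - 0) ^ k) - p.eval z‖ ≤ ε := by
  obtain ⟨h, hh⟩ := exists_dense_polys K hK
  let S := {x : Polynomial ℂ × ℕ // x.1.natDegree ≤ x.2 ∧ ∀ i, ‖x.1.coeff i‖ ≤ 1}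
  have hstep : ∀ (k : ℕ) (x : S), ∃ y : S, x.1.2 < y.1.2 ∧
      (∀ i ≤ x.1.2, y.1.1.coeff i = x.1.1.coeff i) ∧
      ∀ z ∈ K, ‖β y.1.2 * y.1.1.eval z - (h k).eval z‖ ≤ 1 / ((k:ℝ) + 1) := by
    rintro k ⟨⟨Q, N⟩, hQ, hQ1⟩
    obtain ⟨n, hn, Q', h1, h2, h3, h4⟩ := univ_step β K hK σ τ hσ hστ hτ hw hβ Q (h k) N hQ hQ1
      (1 / ((k:ℝ) + 1)) (by positivity)
    exact ⟨⟨⟨Q', n⟩, h1, h3⟩, hn, h2, h4⟩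
  choose nxt hn1 hn2 hn3 using hstep
  let x : ℕ → S := fun k => Nat.rec ⟨⟨0, 0⟩, by simp⟩ (fun k y => nxt k y) k
  have hx : ∀ k, x (k + 1) = nxt k (x k) := fun k => rfl
  have hmono : StrictMono (fun k => (x k).1.2) := strictMono_nat_of_lt_succ fun k => by
    rw [hx]; exact hn1 k (x k)
  have hge : ∀ k, k ≤ (x k).1.2 := fun k => hmono.le_apply
  have hcoh : ∀ k l, k ≤ l → ∀ i ≤ (x k).1.2, (x l).1.1.coeff i = (x k).1.1.coeff i := by
    intro k l hkl
    induction l, hkl using Nat.le_induction with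
    | base => intros; rfl
    | succ l hl ih =>
      intro i hi
      rw [hx, hn2 l (x l) i (hi.trans (hmono.monotone hl)), ih i hi]
  obtain ⟨f, hfd, hfc⟩ := exists_series (fun i => (x i).1.1.coeff i) (fun i => (x i).2.2 i)
  refine ⟨f, hfd, fun p ε hε => ?_⟩
  obtain ⟨k₀, hk₀⟩ := exists_nat_one_div_lt (half_pos hε)
  obtain ⟨k, hk, hkp⟩ := hh p (ε / 2) (half_pos hε) k₀
  refine ⟨(x (k+1)).1.2, (Nat.le_add_left 1 k).trans (hge (k+1)), fun z hz => ?_⟩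
  have hsum : (∑ i ∈ Finset.range ((x (k+1)).1.2 + 1),
        (iteratedDeriv i f 0 / (Nat.factorial i)) * (z - 0) ^ i) = (x (k+1)).1.1.eval z := by
    rw [Polynomial.eval_eq_sum_range' (Nat.lt_succ_of_le (x (k+1)).2.1)]
    refine Finset.sum_congr rfl fun i hi => ?_
    rw [hfc i, sub_zero]
    congr 1
    have hi' : i ≤ (x (k+1)).1.2 := Nat.lt_succ_iff.1 (Finset.mem_range.1 hi)
    rcases le_total i (k+1) with h1 | h1
    · exact (hcoh i (k+1) h1 i (hge i)).symm
    · exact hcoh (k+1) i h1 i hi'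
  rw [hsum]
  have h1 := hn3 k (x k) z hz
  rw [← hx] at h1
  have h2 := hkp z hz
  have h3 : 1 / ((k:ℝ) + 1) ≤ 1 / ((k₀:ℝ) + 1) := by
    have : (k₀:ℝ) ≤ k := by exact_mod_cast hk
    gcongr
  calc ‖β (x (k+1)).1.2 * (x (k+1)).1.1.eval z - p.eval z‖
      = ‖(β (x (k+1)).1.2 * (x (k+1)).1.1.eval z - (h k).eval z) + ((h k).eval z - p.eval z)‖ := by
        ring_nf
    _ ≤ _ := norm_add_le _ _
    _ ≤ ε := by linarith


/-- Theorem 1.1(i): if the set of limit points of `(|β_n|^{1/n})` meets `(ρ_L, 1/ρ_L)`,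
where `L = D̄ ∪ K`, then `U(0, D, K, (β_n)) ≠ ∅`. -/
theorem stmt0 (β : ℕ → ℂ) (K : Set ℂ)
    (hKc : IsCompact K) (hKD : Disjoint K (Metric.closedBall (0:ℂ) 1))
    (hKnt : K.Nontrivial) (hKconn : IsConnected K) (hKcc : IsConnected Kᶜ)
    (F : ℂ → ℂ) (hF0 : ∀ z ∈ Metric.closedBall (0:ℂ) 1, F z = 0)
    (hF1 : ∀ z ∈ K, F z = 1)
    (hlim : ∃ a ∈ Set.Ioo (rho (Metric.closedBall (0:ℂ) 1 ∪ K) F)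
        (1 / rho (Metric.closedBall (0:ℂ) 1 ∪ K) F),
      MapClusterPt a Filter.atTop (fun n : ℕ => ‖β n‖ ^ (1 / (n : ℝ)))) :
    (UD K β).Nonempty := by
  obtain ⟨a, ⟨ha1, ha2⟩, hcl⟩ := hlim
  set L := Metric.closedBall (0:ℂ) 1 ∪ K with hL
  set ρ := rho L F with hρ
  have hLne : L.Nonempty := ⟨0, Or.inl (by simp)⟩
  have hLc : IsCompact L := (isCompact_closedBall (0:ℂ) 1).union hKc
  -- supNorm facts
  have hbdd : ∀ p : Polynomial ℂ, BddAbove ((fun z => ‖F z - p.eval z‖) '' L) := by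
    intro p
    obtain ⟨A, hA⟩ := (hLc.image p.continuous).isBounded.exists_norm_le
    refine ⟨1 + A, ?_⟩
    rintro _ ⟨z, hz, rfl⟩
    have h1 : ‖F z‖ ≤ 1 := by
      rcases hz with hz | hz
      · simp [hF0 z hz]
      · simp [hF1 z hz]
    have h2 := hA _ ⟨z, hz, rfl⟩
    exact (norm_sub_le _ _).trans (add_le_add h1 h2)
  have hsn : ∀ p : Polynomial ℂ, ∀ z ∈ L, ‖F z - p.eval z‖ ≤
      supNorm (fun z => F z - Polynomial.eval z p) L := fun p z hz =>
    le_csSup (hbdd p) ⟨z, hz, rfl⟩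
  have hsn0 : ∀ p : Polynomial ℂ, 0 ≤ supNorm (fun z => F z - Polynomial.eval z p) L := fun p =>
    (norm_nonneg _).trans (hsn p 0 (Or.inl (by simp)))
  have hd0 : ∀ n, 0 ≤ dApprox L F n := by
    intro n
    apply Real.sInf_nonneg
    rintro c ⟨p, -, rfl⟩
    exact hsn0 p
  have hd1 : ∀ n, dApprox L F n ≤ 1 := by
    intro n
    have h1 : dApprox L F n ≤ supNorm (fun z => F z - Polynomial.eval z 0) L := by
      apply csInf_le
      · refine ⟨0, ?_⟩
        rintro c ⟨p, -, rfl⟩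
        exact hsn0 p
      · exact ⟨0, by simp, rfl⟩
    refine h1.trans ?_
    apply csSup_le (hLne.image _)
    rintro _ ⟨z, hz, rfl⟩
    rcases hz with hz | hz
    · simp [hF0 z hz]
    · simp [hF1 z hz]
  have ha0 : 0 ≤ a := by
    by_contra hneg
    push Not at hneg
    obtain ⟨n, hn⟩ := (hcl.frequently (gt_mem_nhds hneg)).exists
    exact absurd hn (not_lt.2 (by positivity))
  have hρ0 : 0 < ρ := by
    by_contra hneg
    push Not at hneg
    have : 1 / ρ ≤ 0 := by
      rw [one_div]; exact inv_nonpos.2 hneg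
    linarith
  have hapos : 0 < a := hρ0.trans ha1
  have hρa : ρ < 1 / a := by
    rw [lt_div_iff₀ hapos]
    rw [lt_div_iff₀ hρ0] at ha2
    linarith
  obtain ⟨σ, hσ1, hσ2⟩ := exists_between (lt_min ha1 hρa)
  obtain ⟨τ, hτ1, hτ2⟩ := exists_between hσ2
  have hτa : τ < a := hτ2.trans_le (min_le_left _ _)
  have hτa' : τ < 1 / a := hτ2.trans_le (min_le_right _ _)
  have hσ0 : 0 < σ := hρ0.trans hσ1
  have hτ0 : 0 < τ := hσ0.trans hτ1
  have haτ : a < 1 / τ := by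
    rw [lt_div_iff₀ hapos] at hτa'
    rw [lt_div_iff₀ hτ0]; linarith
  have hττ : τ < 1 := by
    rw [lt_div_iff₀ hapos] at hτa'
    nlinarith
  have hw : ∀ᶠ n : ℕ in atTop, ∃ p : Polynomial ℂ, p.natDegree ≤ n ∧
      (∀ z ∈ closedBall (0:ℂ) 1, ‖p.eval z‖ ≤ σ ^ n) ∧ ∀ z ∈ K, ‖1 - p.eval z‖ ≤ σ ^ n := by
    have hbu : IsBoundedUnder (· ≤ ·) atTop (fun n : ℕ => dApprox L F n ^ (1 / (n : ℝ))) := by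
      refine isBoundedUnder_of ⟨1, fun n => ?_⟩
      exact Real.rpow_le_one (hd0 n) (hd1 n) (by positivity)
    have hev := eventually_lt_of_limsup_lt (hσ1 : limsup _ _ < σ) hbu
    filter_upwards [hev, eventually_gt_atTop 0] with n hn hn0
    have hlt : dApprox L F n < σ ^ n := by
      have h1 : (dApprox L F n ^ (1 / (n : ℝ))) ^ n < σ ^ n :=
        pow_lt_pow_left₀ hn (Real.rpow_nonneg (hd0 n) _) hn0.ne'
      rwa [one_div, Real.rpow_inv_natCast_pow (hd0 n) hn0.ne'] at h1
    obtain ⟨c, ⟨p, hpd, rfl⟩, hc⟩ := exists_lt_of_csInf_lt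
      (by exact ⟨_, 0, by simp, rfl⟩) hlt
    refine ⟨p, Polynomial.natDegree_le_of_degree_le hpd, fun z hz => ?_, fun z hz => ?_⟩
    · have := hsn p z (Or.inl hz)
      rw [hF0 z hz, zero_sub, norm_neg] at this
      exact this.trans hc.le
    · have := hsn p z (Or.inr hz)
      rw [hF1 z hz] at this
      exact this.trans hc.le
  have hβ : ∃ᶠ n : ℕ in atTop, τ ^ n ≤ ‖β n‖ ∧ ‖β n‖ ≤ (τ ^ n)⁻¹ := by
    have h1 := (hcl.frequently (Ioo_mem_nhds hτa haτ)).and_eventually (eventually_gt_atTop 0)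
    refine h1.mono ?_
    rintro n ⟨⟨hn1, hn2⟩, hn0⟩
    have e1 : (‖β n‖ ^ (1 / (n : ℝ))) ^ n = ‖β n‖ := by
      rw [one_div, Real.rpow_inv_natCast_pow (norm_nonneg _) hn0.ne']
    constructor
    · rw [← e1]; exact pow_le_pow_left₀ hτ0.le hn1.le n
    · rw [← e1, ← inv_pow, ← one_div τ]
      exact pow_le_pow_left₀ (by positivity) hn2.le n
  obtain ⟨f, hfd, hf⟩ := univ_exists β K hKc σ τ hσ0 hτ1 hττ hw hβ
  refine ⟨f, hfd, fun h hh ε hε => ?_⟩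
  obtain ⟨p, hp⟩ := mergelyan K hKc hKcc h hh.1 hh.2 (ε / 4) (by positivity)
  obtain ⟨n, hn1, hn⟩ := hf p (ε / 4) (by positivity)
  refine ⟨n, hn1, ?_⟩
  have : supNorm (fun z => β n * taylorSum f 0 n z - h z) K ≤ ε / 2 := by
    apply csSup_le (hKnt.nonempty.image _)
    rintro _ ⟨z, hz, rfl⟩
    have h1 := hn z hz
    have h2 := hp z hz
    calc ‖β n * taylorSum f 0 n z - h z‖
        = ‖(β n * taylorSum f 0 n z - p.eval z) + (p.eval z - h z)‖ := by ring_nf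
      _ ≤ ‖β n * taylorSum f 0 n z - p.eval z‖ + ‖p.eval z - h z‖ := norm_add_le _ _
      _ ≤ ε / 2 := by unfold taylorSum; linarith
  linarith
end

section
/- Let (β_n)_{n≥1} be a sequence of complex numbers. Let K ⊆ ℂ be a compact set disjoint from the closed unit disc D̄, containing more than one point, connected, and with connected complement. If limsup_{n→∞} |β_n|^{1/n} < 1/dist(0,K), where dist(0,K) := inf{|w| : w ∈ K}, then U(0, D, K, (β_n)) = ∅. -/
open Filter Topology Metric

/-- Theorem 1.1(ii): if `limsup |β_n|^{1/n} < 1/dist(0,K)` then `U(0, D, K, (β_n)) = ∅`. -/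
theorem stmt1 (β : ℕ → ℂ) (K : Set ℂ)
    (hKc : IsCompact K) (hKD : Disjoint K (Metric.closedBall (0:ℂ) 1))
    (hKnt : K.Nontrivial) (hKconn : IsConnected K) (hKcc : IsConnected Kᶜ)
    (hlim : Filter.limsup (fun n : ℕ => ((‖β n‖ ^ (1 / (n : ℝ)) : ℝ) : EReal))
        Filter.atTop < ((1 / Metric.infDist (0:ℂ) K : ℝ) : EReal)) :
    UD K β = ∅ := by
  obtain ⟨z, hzK, hz⟩ := hKc.exists_infDist_eq_dist hKconn.nonempty (0:ℂ)
  rw [dist_zero_left] at hz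
  have hd1 : 1 < ‖z‖ := by
    have := Set.disjoint_left.1 hKD hzK
    simpa using this
  rw [hz] at hlim
  obtain ⟨q, hq1, hq2⟩ := EReal.lt_iff_exists_real_btwn.1 hlim
  have hq2 : q < 1 / ‖z‖ := by exact_mod_cast hq2
  have hβ : ∀ᶠ n : ℕ in atTop, ‖β n‖ ≤ q ^ n ∧ 0 < q := by
    filter_upwards [Filter.eventually_lt_of_limsup_lt hq1, eventually_ge_atTop 1] with n hn hn1
    have hn : ‖β n‖ ^ (1 / (n : ℝ)) < q := by exact_mod_cast hn
    have h0 : 0 ≤ ‖β n‖ ^ (1 / (n : ℝ)) := by positivity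
    refine ⟨?_, lt_of_le_of_lt h0 hn⟩
    calc ‖β n‖ = (‖β n‖ ^ (1 / (n : ℝ))) ^ n := by
          rw [one_div, Real.rpow_inv_natCast_pow (norm_nonneg _) (by omega)]
      _ ≤ q ^ n := pow_le_pow_left₀ h0 hn.le n
  have hq0 : 0 < q := by
    obtain ⟨n, hn⟩ := hβ.exists
    exact hn.2
  have hqd : q * ‖z‖ < 1 := by
    rwa [lt_div_iff₀ (by linarith)] at hq2
  obtain ⟨r, hr1, hr2⟩ := exists_between hqd
  have hr0 : 0 < r := lt_trans (by positivity) hr1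
  rw [Set.eq_empty_iff_forall_notMem]
  rintro f ⟨hf, hdense⟩
  -- Cauchy estimate
  obtain ⟨C, hC⟩ : ∃ C : ℝ, ∀ w ∈ sphere (0:ℂ) r, ‖f w‖ ≤ C := by
    apply (isCompact_sphere (0:ℂ) r).exists_bound_of_continuousOn
    exact hf.continuousOn.mono (fun w hw => by
      simp only [mem_sphere, dist_zero_right] at hw
      simp [hw, hr2])
  have hC0 : 0 ≤ C := (norm_nonneg _).trans (hC (r : ℂ) (by simp [abs_of_pos hr0]))
  have hcoef : ∀ k : ℕ, ‖iteratedDeriv k f 0 / (Nat.factorial k)‖ ≤ C / r ^ k := by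
    intro k
    have h1 : DiffContOnCl ℂ f (ball 0 r) := by
      apply DifferentiableOn.diffContOnCl
      rw [closure_ball _ hr0.ne']
      exact hf.mono (closedBall_subset_ball hr2)
    have := Complex.norm_iteratedDeriv_le_of_forall_mem_sphere_norm_le k hr0 h1 hC
    rw [norm_div, Complex.norm_natCast, div_le_iff₀ (by positivity)]
    calc _ ≤ _ := this
      _ = _ := by ring
  have hS : ∀ n : ℕ, ‖taylorSum f 0 n z‖ ≤ (n + 1) * (C * (‖z‖ / r) ^ n) := by
    intro n
    unfold taylorSum
    calc _ ≤ ∑ k ∈ Finset.range (n + 1), (C * (‖z‖ / r) ^ n) := by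
          apply norm_sum_le_of_le
          intro k hk
          rw [norm_mul, sub_zero, norm_pow]
          calc _ ≤ C / r ^ k * ‖z‖ ^ k := by gcongr; exact hcoef k
            _ = C * (‖z‖ / r) ^ k := by rw [div_pow]; ring
            _ ≤ _ := by
              gcongr
              · rw [le_div_iff₀ hr0]; linarith
              · exact Nat.lt_succ_iff.1 (Finset.mem_range.1 hk)
      _ = _ := by simp
  have hx1 : q * (‖z‖ / r) < 1 := by
    rw [← mul_div_assoc, div_lt_one hr0]; exact hr1
  have hx0 : 0 ≤ q * (‖z‖ / r) := by positivity
  have hlim0 : Tendsto (fun n : ℕ => C * ((n:ℝ) * (q * (‖z‖ / r)) ^ n + (q * (‖z‖ / r)) ^ n))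
      atTop (𝓝 0) := by
    have := ((tendsto_self_mul_const_pow_of_lt_one hx0 hx1).add
      (tendsto_pow_atTop_nhds_zero_of_lt_one hx0 hx1)).const_mul C
    simpa using this
  have htend : Tendsto (fun n : ℕ => β n * taylorSum f 0 n z) atTop (𝓝 0) := by
    apply squeeze_zero_norm' _ hlim0
    filter_upwards [hβ] with n hn
    rw [norm_mul]
    calc _ ≤ q ^ n * ((n + 1) * (C * (‖z‖ / r) ^ n)) := by
          gcongr
          · exact hn.1
          · exact hS n
      _ = _ := by rw [mul_pow]; ring
  obtain ⟨M, hM⟩ := (Metric.isBounded_range_of_tendsto _ htend).exists_norm_le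
  have hM : ∀ n, ‖β n * taylorSum f 0 n z‖ ≤ M := fun n => hM _ ⟨n, rfl⟩
  have hM0 : 0 ≤ M := (norm_nonneg _).trans (hM 0)
  obtain ⟨n, -, hn⟩ := hdense (fun _ => ((M + 1 : ℝ) : ℂ))
    ⟨continuousOn_const, differentiableOn_const _⟩ 1 one_pos
  have hle : ‖β n * taylorSum f 0 n z - ((M + 1 : ℝ) : ℂ)‖ < 1 := by
    refine lt_of_le_of_lt (le_csSup ?_ (Set.mem_image_of_mem
      (fun w => ‖β n * taylorSum f 0 n w - ((M + 1 : ℝ) : ℂ)‖) hzK)) hn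
    apply (hKc.image_of_continuousOn _).bddAbove
    apply Continuous.continuousOn
    unfold taylorSum
    fun_prop
  have h3 := norm_sub_norm_le ((M + 1 : ℝ) : ℂ) (β n * taylorSum f 0 n z)
  rw [norm_sub_rev, Complex.norm_real, Real.norm_of_nonneg (by linarith)] at h3
  have := hM n
  linarith
end
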